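/- arXiv:2406.16475 — 3 statements merged into one kernel-verified Lean document; each statement's English description precedes it below -/
import Mathlib

section
/- Let x and y be two strings over the binary alphabet {a, b} with a ≺ b, having the same length and the same Parikh vector (the same number of occurrences of a and of b). Then there is a finite composition of the operations rot and BBWT that maps x to y. -/
open List

variable {α : Type*} [LinearOrder α]

/-- A Lyndon word: nonempty and lexicographically strictly smaller than all of
its proper nonempty suffixes. -/
def IsLyndon (w : List α) : Prop :=
  w ≠ [] ∧ ∀ i, 0 < i → i < w.length → w < w.drop i

/-- `fs` is the Lyndon factorization of `w` (factors listed with multiplicity,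
so a necklace `f_i^{k_i}` contributes `k_i` copies of `f_i`): the factors
concatenate to `w`, each factor is Lyndon, and the sequence of factors is
lexicographically non-increasing. -/
def IsLyndonFactorization (w : List α) (fs : List (List α)) : Prop :=
  fs.flatten = w ∧ (∀ f ∈ fs, IsLyndon f) ∧ fs.Chain' (fun a b => b ≤ a)

/-- All cyclic rotations of `w` (with multiplicity). -/
def rotations (w : List α) : List (List α) :=
  (List.range w.length).map fun i => w.drop i ++ w.take i

/-- The rotation moving the last character of `w` to the front. -/
def rotR (w : List α) : List α :=
  w.drop (w.length - 1) ++ w.take (w.length - 1)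

/-- Number of maximal runs of equal consecutive characters of `s`. -/
def runCount (s : List α) : ℕ := (s.destutter (· ≠ ·)).length

/-- The Burrows–Wheeler transform: concatenation of the last characters of all
`|w|` cyclic rotations of `w`, listed in lexicographic order. -/
def BWT (w : List α) : List α :=
  (List.insertionSort (· ≤ ·) (rotations w)).flatMap fun r => r.getLast?.toList

/-- The ω-order comparison: `x ≼_ω y` iff `x^∞ ≤ y^∞`, equivalently `xy ≤ yx`. -/
def omegaLE (x y : List α) : Prop := x ++ y ≤ y ++ x

instance : DecidableRel (omegaLE (α := α)) := fun x y =>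
  inferInstanceAs (Decidable (x ++ y ≤ y ++ x))

/-- The bijective Burrows–Wheeler transform, expressed in terms of the Lyndon
factorization `fs` of a word: concatenation of the last characters of all
cyclic rotations of all Lyndon factors (with multiplicity), listed in ω-order. -/
def BBWTof (fs : List (List α)) : List α :=
  (List.insertionSort omegaLE (fs.flatMap rotations)).flatMap fun r => r.getLast?.toList

/-- One application of either the rotation operation or the BBWT operation
(the latter expressed via the Lyndon factorization of the input). -/
def BBWTRotStep (u v : List α) : Prop :=
  v = rotR u ∨ ∃ fs, IsLyndonFactorization u fs ∧ v = BBWTof fs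


namespace BB

/-- digit -/
def dg (b : Bool) : ℚ := if b then 1 else 0

/-- base-3 fraction value of a word -/
def fr : List Bool → ℚ
  | [] => 0
  | b :: l => dg b + fr l / 3

/-- value of the periodic word -/
def rho (l : List Bool) : ℚ := fr l / (1 - (1/3)^l.length)

theorem fr_append (x y : List Bool) : fr (x ++ y) = fr x + fr y * (1/3)^x.length := by
  induction x with
  | nil => simp [fr]
  | cons a x ih => simp only [List.cons_append, fr, ih, List.length_cons, pow_succ]; ring

theorem dg_nonneg (b : Bool) : 0 ≤ dg b := by cases b <;> simp [dg]
theorem dg_le (b : Bool) : dg b ≤ 1 := by cases b <;> simp [dg]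

theorem fr_nonneg (x : List Bool) : 0 ≤ fr x := by
  induction x with
  | nil => simp [fr]
  | cons a x ih => have := dg_nonneg a; simp only [fr]; positivity

theorem fr_le (x : List Bool) : fr x ≤ 3/2 * (1 - (1/3)^x.length) := by
  induction x with
  | nil => simp [fr]
  | cons a x ih =>
    have := dg_le a
    simp only [fr, List.length_cons, pow_succ]; linarith

theorem pow_pos3 (n : ℕ) : (0:ℚ) < (1/3)^n := by positivity

theorem fr_lt (x : List Bool) : fr x < 3/2 := by
  have := fr_le x
  have := pow_pos3 x.length
  linarith

theorem den_pos (x : List Bool) (h : x ≠ []) : (0:ℚ) < 1 - (1/3)^x.length := by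
  have : (1/3:ℚ)^x.length < 1 := pow_lt_one₀ (by norm_num) (by norm_num) (by simpa using h)
  linarith

theorem lt_iff (x y : List Bool) (h : x.length = y.length) : x < y ↔ fr x < fr y := by
  induction x generalizing y with
  | nil =>
    have : y = [] := by simpa using h.symm
    subst this; simp
  | cons a x ih =>
    cases y with
    | nil => simp at h
    | cons b y =>
      have ih' := ih y (by simpa using h)
      rw [List.cons_lt_cons_iff, ih']
      have h1 := fr_nonneg x
      have h2 := fr_nonneg y
      have h3 := fr_lt x
      have h4 := fr_lt y
      have ht : ¬ (true < false) := by decide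
      have ht' : false < true := by decide
      cases a <;> cases b <;> simp only [fr, dg, ht, ht', lt_irrefl] <;> constructor <;>
        simp <;> intros <;> linarith

theorem le_iff (x y : List Bool) (h : x.length = y.length) : x ≤ y ↔ fr x ≤ fr y := by
  rw [← not_lt, ← not_lt, lt_iff y x h.symm]

theorem fr_inj (x y : List Bool) (h : x.length = y.length) (e : fr x = fr y) : x = y :=
  le_antisymm ((le_iff x y h).2 e.le) ((le_iff y x h.symm).2 e.ge)

theorem omega_iff (x y : List Bool) (hx : x ≠ []) (hy : y ≠ []) :
    omegaLE x y ↔ rho x ≤ rho y := by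
  unfold omegaLE
  rw [le_iff _ _ (by simp; omega), fr_append, fr_append, rho, rho,
    div_le_div_iff₀ (den_pos x hx) (den_pos y hy)]
  constructor <;> intro h <;> linarith

theorem rho_cons (a : Bool) (m : List Bool) : rho (a :: m) = dg a + rho (m ++ [a]) / 3 := by
  have := den_pos (a :: m) (by simp)
  unfold rho
  simp only [List.length_append, List.length_cons, List.length_nil, zero_add, fr, fr_append] at *
  have h : (1 - (1/3:ℚ)^(m.length+1)) ≠ 0 := this.ne'
  rw [div_eq_iff h, add_mul, div_div, mul_comm _ (3:ℚ), ← div_div, div_mul_eq_mul_div, div_mul_eq_mul_div]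
  field_simp
  ring

theorem rho_nonneg (x : List Bool) : 0 ≤ rho x := by
  by_cases h : x = []
  · subst h; simp [rho]
  · exact div_nonneg (fr_nonneg x) (den_pos x h).le

theorem rho_le (x : List Bool) : rho x ≤ 3/2 := by
  by_cases h : x = []
  · subst h; norm_num [rho, fr]
  · rw [rho, div_le_iff₀ (den_pos x h)]; exact fr_le x

/-! ### comparisons of words of different length -/

theorem prefix_or (x y : List Bool) (h : x < y) :
    x <+: y ∨ ∀ u v, x ++ u < y ++ v := by
  induction x generalizing y with
  | nil => left; simp
  | cons a x ih =>
    cases y with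
    | nil => simp at h
    | cons b y =>
      rw [List.cons_lt_cons_iff] at h
      rcases h with h | ⟨rfl, h⟩
      · right; intro u v
        simp only [List.cons_append]
        rw [List.cons_lt_cons_iff]; exact Or.inl h
      · rcases ih y h with h' | h'
        · left; simpa using h'
        · right; intro u v
          simp only [List.cons_append]
          rw [List.cons_lt_cons_iff]; exact Or.inr ⟨rfl, h' u v⟩

theorem append_lt_left (x y z : List Bool) : x ++ y < x ++ z ↔ y < z := by
  induction x with
  | nil => simp
  | cons a x ih => simp only [List.cons_append]; rw [List.cons_lt_cons_iff]; simp [ih]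

theorem le_append (x y : List Bool) : x ≤ x ++ y := by
  rw [← not_lt]; intro h
  induction x with
  | nil => simp at h
  | cons a x ih => simp only [List.cons_append] at h; rw [List.cons_lt_cons_iff] at h; simp at h; exact ih h

theorem lyndon_of_rot (w : List Bool) (hne : w ≠ [])
    (h : ∀ p, 0 < p → p < w.length → w < w.drop p ++ w.take p) : IsLyndon w := by
  refine ⟨hne, fun p hp hpl => ?_⟩
  by_contra hc
  have hlt : w.drop p < w := by
    rcases lt_trichotomy w (w.drop p) with h1 | h1 | h1
    · exact absurd h1 hc
    · have := congrArg List.length h1; simp at this; omega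
    · exact h1
  rcases prefix_or _ _ hlt with ⟨y, hy⟩ | h1
  · have h2 := h p hp hpl
    have hyl : y.length = p := by
      have := congrArg List.length hy; simp at this; omega
    have h3 : y < w.take p := by
      rw [← append_lt_left (w.drop p), hy]; exact h2
    have hd : w.drop (w.length - p) = y := by
      have : w.drop (w.length - p) = (w.drop p ++ y).drop (w.length - p) := by rw [hy]
      rw [this, List.drop_left' (by simp)]
    have ht : w.take (w.length - p) = w.drop p := by
      have : w.take (w.length - p) = (w.drop p ++ y).take (w.length - p) := by rw [hy]
      rw [this, List.take_left' (by simp)]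
    have h4 := h (w.length - p) (by omega) (by omega)
    rw [hd, ht] at h4
    rw [lt_iff _ _ (by simp [hyl]; omega)] at h3
    have h5 : w < y ++ w.drop p := h4
    rw [lt_iff _ _ (by simp [hyl]; omega), ← List.take_append_drop p w, fr_append, fr_append] at h5
    simp only [List.take_append_drop] at h5
    have : (w.take p).length = y.length := by simp [hyl]; omega
    rw [this] at h5
    linarith
  · have := h1 (w.take p) []
    rw [List.append_nil] at this
    exact absurd (h p hp hpl) (not_lt.2 this.le)

theorem le_of_omega (x y : List Bool) (hx : IsLyndon x) (hy : y ≠ []) (h : omegaLE x y) : x ≤ y := by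
  by_contra hc
  have hlt : y < x := not_le.1 hc
  rcases prefix_or _ _ hlt with ⟨z, hz⟩ | h1
  · have hzne : z ≠ [] := by rintro rfl; simp at hz; simp [hz] at hlt
    have hyl : 0 < y.length := List.length_pos_iff.2 hy
    have h1 := hx.2 y.length hyl (by rw [← hz]; simp; exact List.length_pos_iff.2 hzne)
    have : x.drop y.length = z := by rw [← hz]; simp
    rw [this] at h1
    unfold omegaLE at h
    have h2 : z ++ y ≤ x := by
      rw [← not_lt, ← append_lt_left y, not_lt]
      calc y ++ (z ++ y) = x ++ y := by rw [← hz]; simp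
        _ ≤ _ := h
    exact absurd h1 (not_lt.2 ((le_append z y).trans h2))
  · exact absurd (h1 x y) (not_lt.2 h)

/-! ### uniqueness of the Lyndon factorization -/

theorem fac_aux (f : List Bool) (fs : List (List Bool)) (hfs : ∀ g ∈ fs, IsLyndon g ∧ g ≤ f)
    (p : List Bool) (hp : p ≠ []) (hpre : p <+: fs.flatten) :
    ∃ q, q ≠ [] ∧ q <:+ p ∧ q ≤ f := by
  induction fs generalizing p with
  | nil => simp at hpre; exact absurd hpre hp
  | cons g gs ih =>
    simp only [List.flatten_cons] at hpre
    rcases le_or_gt p.length g.length with hl | hl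
    · have : p <+: g := List.prefix_of_prefix_length_le hpre (List.prefix_append _ _) hl
      obtain ⟨z, hz⟩ := this
      refine ⟨p, hp, List.suffix_refl _, ?_⟩
      exact (le_append p z).trans (hz ▸ (hfs g (by simp)).2)
    · have : g <+: p := List.prefix_of_prefix_length_le (List.prefix_append _ _) hpre hl.le
      obtain ⟨z, rfl⟩ := this
      have hz : z ≠ [] := by rintro rfl; simp at hl
      obtain ⟨q, h1, h2, h3⟩ := ih (fun g' hg' => hfs g' (by simp [hg'])) z hz
        ((List.prefix_append_right_inj g).1 hpre)
      exact ⟨q, h1, h2.trans (List.suffix_append _ _), h3⟩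

theorem fac_len (f f' : List Bool) (fs fs' : List (List Bool)) (hf : f ≠ []) (hf' : IsLyndon f')
    (hfs : ∀ g ∈ fs, IsLyndon g ∧ g ≤ f) (h : f ++ fs.flatten = f' ++ fs'.flatten) :
    f'.length ≤ f.length := by
  by_contra hc
  push Not at hc
  have hpre : f <+: f' := List.prefix_of_prefix_length_le (List.prefix_append f fs.flatten)
    (h ▸ List.prefix_append f' fs'.flatten) hc.le
  obtain ⟨p, rfl⟩ := hpre
  have hp : p ≠ [] := by rintro rfl; simp at hc
  rw [List.append_assoc, List.append_cancel_left_eq] at h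
  obtain ⟨q, h1, ⟨r, h2⟩, h3⟩ := fac_aux f fs hfs p hp (h ▸ List.prefix_append _ _)
  have hfl := List.length_pos_iff.2 hf
  have hql := List.length_pos_iff.2 h1
  subst h2
  have := hf'.2 (f.length + r.length) (by omega) (by simp; omega)
  have e : (f ++ (r ++ q)).drop (f.length + r.length) = q := by
    rw [← List.append_assoc, ← List.length_append, List.drop_left]
  rw [e] at this
  exact absurd this (not_lt.2 (h3.trans (le_append _ _)))

theorem fac_unique (fs fs' : List (List Bool))
    (h1 : ∀ f ∈ fs, IsLyndon f) (h1' : ∀ f ∈ fs', IsLyndon f)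
    (h2 : fs.Pairwise (fun a b => b ≤ a)) (h2' : fs'.Pairwise (fun a b => b ≤ a))
    (h : fs.flatten = fs'.flatten) : fs = fs' := by
  induction fs generalizing fs' with
  | nil =>
    cases fs' with
    | nil => rfl
    | cons g gs =>
      have := (h1' g (by simp)).1
      simp at h; exact absurd h.1 this
  | cons f fs ih =>
    cases fs' with
    | nil =>
      have := (h1 f (by simp)).1
      simp at h; exact absurd h.1 this
    | cons g gs =>
      simp only [List.flatten_cons] at h
      rw [List.pairwise_cons] at h2 h2'
      have hl : f.length = g.length := le_antisymm
        (fac_len g f gs fs (h1' g (by simp)).1 (h1 f (by simp))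
          (fun a ha => ⟨h1' a (by simp [ha]), h2'.1 a ha⟩) h.symm)
        (fac_len f g fs gs (h1 f (by simp)).1 (h1' g (by simp))
          (fun a ha => ⟨h1 a (by simp [ha]), h2.1 a ha⟩) h)
      obtain ⟨e1, e2⟩ := List.append_inj h hl
      rw [e1, ih gs (fun a ha => h1 a (by simp [ha])) (fun a ha => h1' a (by simp [ha])) h2.2 h2'.2 e2]

end BB

namespace BB

section orbit

variable {n : ℕ} (s : Equiv.Perm (Fin n)) (L : Fin n → Bool)

/-- word of the cycle of `s` starting at row `i` -/
noncomputable def wd (i : Fin n) : List Bool :=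
  (List.range (Function.minimalPeriod s i)).map fun t => L (s (s^[t] i))

theorem mper (i : Fin n) : i ∈ Function.periodicPts s := s.injective.mem_periodicPts i

theorem per_pos (i : Fin n) : 0 < Function.minimalPeriod s i :=
  Function.minimalPeriod_pos_of_mem_periodicPts (mper s i)

theorem wd_length (i : Fin n) : (wd s L i).length = Function.minimalPeriod s i := by simp [wd]

theorem wd_ne (i : Fin n) : wd s L i ≠ [] := by
  have := per_pos s i
  intro h
  have h2 := wd_length s L i
  rw [h] at h2; simp at h2; omega

theorem wd_cons (i : Fin n) : ∃ m, wd s L i = L (s i) :: m ∧ wd s L (s i) = m ++ [L (s i)] := by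
  obtain ⟨c, hc⟩ := Nat.exists_eq_succ_of_ne_zero (per_pos s i).ne'
  refine ⟨(List.range c).map fun t => L (s (s^[t] (s i))), ?_, ?_⟩
  · rw [wd, hc, List.range_succ_eq_map]; simp [Function.comp_def]
  · rw [wd, Function.minimalPeriod_apply (mper s i), hc, List.range_succ]
    simp only [List.map_append, List.map_cons, List.map_nil, List.append_cancel_left_eq]
    have : s^[c] (s i) = i := by
      rw [← Function.iterate_succ_apply]
      have := Function.iterate_minimalPeriod (f := s) (x := i)
      rwa [hc] at this
    rw [this]

theorem wd_rotate (i : Fin n) (p : ℕ) : wd s L (s^[p] i) = (wd s L i).rotate p := by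
  induction p with
  | zero => simp
  | succ p ih =>
    rw [Function.iterate_succ_apply', ← List.rotate_rotate, ← ih]
    obtain ⟨m, h1, h2⟩ := wd_cons s L (s^[p] i)
    rw [h1, h2]; simp

theorem wd_last (i : Fin n) : (wd s L i).getLast?.toList = [L i] := by
  obtain ⟨j, rfl⟩ := s.surjective i
  obtain ⟨m, h1, h2⟩ := wd_cons s L j
  rw [h2]; simp

theorem wd_rotations (i : Fin n) :
    rotations (wd s L i) = (List.range (Function.minimalPeriod s i)).map fun t => wd s L (s^[t] i) := by
  unfold rotations
  rw [wd_length]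
  apply List.map_congr_left
  intro p hp
  rw [wd_rotate, List.rotate_eq_drop_append_take]
  rw [wd_length]; simp at hp; omega

/-- value of row `i` -/
noncomputable def rr (i : Fin n) : ℚ := rho (wd s L i)

theorem rr_eq (i : Fin n) : rr s L i = dg (L (s i)) + rr s L (s i) / 3 := by
  obtain ⟨m, h1, h2⟩ := wd_cons s L i
  rw [rr, h1, rho_cons, rr, h2]


theorem rr_lt_of (i j : Fin n) (h : L (s i) < L (s j)) : rr s L i < rr s L j := by
  obtain ⟨h1, h2⟩ : L (s i) = false ∧ L (s j) = true := by
    revert h; cases L (s i) <;> cases L (s j) <;> decide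
  rw [rr_eq s L i, rr_eq s L j, h1, h2]
  have := rho_le (wd s L (s i))
  have := rho_nonneg (wd s L (s j))
  simp only [rr, dg]; norm_num; linarith

theorem rr_mono
    (hm : Monotone (L ∘ s)) (hs : ∀ i j, i < j → L (s i) = L (s j) → s i < s j) : Monotone (rr s L) := by
  rw [monotone_iff_forall_lt]
  by_contra hc
  push Not at hc
  obtain ⟨i0, j0, h0, h0'⟩ := hc
  obtain ⟨⟨i, j⟩, hmem, hmax⟩ := Finset.exists_max_image
    (Finset.univ.filter fun q : Fin n × Fin n => q.1 < q.2 ∧ rr s L q.2 < rr s L q.1)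
    (fun q => rr s L q.1 - rr s L q.2) ⟨(i0, j0), by simp [h0, h0']⟩
  simp only [Finset.mem_filter, Finset.mem_univ, true_and] at hmem hmax
  obtain ⟨h1, h2⟩ := hmem
  rcases (hm h1.le).lt_or_eq with h3 | h3
  · exact absurd (rr_lt_of s L i j h3) (not_lt.2 h2.le)
  · have h3' : L (s i) = L (s j) := h3
    have h4 := hs i j h1 h3'
    have e1 := rr_eq s L i
    have e2 := rr_eq s L j
    rw [h3'] at e1
    have := hmax (s i, s j) ⟨h4, by linarith⟩
    simp only at this
    linarith

theorem rr_step (i j : Fin n) (h : rr s L i = rr s L j) :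
    L (s i) = L (s j) ∧ rr s L (s i) = rr s L (s j) := by
  have h1 : L (s i) = L (s j) := by
    rcases lt_trichotomy (L (s i)) (L (s j)) with h1 | h1 | h1
    · exact absurd h (rr_lt_of s L i j h1).ne
    · exact h1
    · exact absurd h (rr_lt_of s L j i h1).ne'
  refine ⟨h1, ?_⟩
  rw [rr_eq s L i, rr_eq s L j, h1] at h
  linarith

theorem rr_iter (i j : Fin n) (h : rr s L i = rr s L j) (t : ℕ) :
    rr s L (s^[t] i) = rr s L (s^[t] j) := by
  induction t with
  | zero => simpa
  | succ t ih =>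
    rw [Function.iterate_succ_apply', Function.iterate_succ_apply']
    exact (rr_step s L _ _ ih).2

theorem lt_iter
    (hm : Monotone (L ∘ s)) (hs : ∀ i j, i < j → L (s i) = L (s j) → s i < s j) (i j : Fin n) (h : rr s L i = rr s L j) (hij : i < j) (t : ℕ) :
    s^[t] i < s^[t] j := by
  induction t with
  | zero => simpa
  | succ t ih =>
    rw [Function.iterate_succ_apply', Function.iterate_succ_apply']
    exact hs _ _ ih (rr_step s L _ _ (rr_iter s L i j h t)).1

theorem fix_of_eq
    (hm : Monotone (L ∘ s)) (hs : ∀ i j, i < j → L (s i) = L (s j) → s i < s j) (i : Fin n) (p : ℕ) (h : rr s L (s^[p] i) = rr s L i) : s^[p] i = i := by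
  rcases lt_trichotomy (s^[p] i) i with h1 | h1 | h1
  · have hA : StrictAnti fun k => s^[p * k] i := by
      apply strictAnti_nat_of_succ_lt
      intro k
      have := lt_iter s L hm hs _ _ h h1 (p * k)
      rwa [← Function.iterate_add_apply] at this
    exact absurd hA.injective (not_injective_infinite_finite _)
  · exact h1
  · have hA : StrictMono fun k => s^[p * k] i := by
      apply strictMono_nat_of_lt_succ
      intro k
      have := lt_iter s L hm hs _ _ h.symm h1 (p * k)
      rwa [← Function.iterate_add_apply] at this
    exact absurd hA.injective (not_injective_infinite_finite _)

theorem per_dvd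
    (hm : Monotone (L ∘ s)) (hs : ∀ i j, i < j → L (s i) = L (s j) → s i < s j) (i j : Fin n) (h : rr s L i = rr s L j) :
    Function.minimalPeriod s j ∣ Function.minimalPeriod s i := by
  apply Function.IsPeriodicPt.minimalPeriod_dvd
  apply fix_of_eq s L hm hs
  rw [← rr_iter s L i j h, Function.iterate_minimalPeriod, h]

theorem wd_eq
    (hm : Monotone (L ∘ s)) (hs : ∀ i j, i < j → L (s i) = L (s j) → s i < s j) (i j : Fin n) (h : rr s L i = rr s L j) : wd s L i = wd s L j := by
  have hp := Nat.dvd_antisymm (per_dvd s L hm hs j i h.symm) (per_dvd s L hm hs i j h)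
  rw [wd, wd, hp]
  apply List.map_congr_left
  intro t _
  exact (rr_step s L _ _ (rr_iter s L i j h t)).1

theorem omega_wd (i j : Fin n) : omegaLE (wd s L i) (wd s L j) ↔ rr s L i ≤ rr s L j :=
  omega_iff _ _ (wd_ne s L i) (wd_ne s L j)

theorem wd_lyndon
    (hm : Monotone (L ∘ s)) (hs : ∀ i j, i < j → L (s i) = L (s j) → s i < s j) (i : Fin n) (hi : ∀ p, i ≤ s^[p] i) : IsLyndon (wd s L i) := by
  apply lyndon_of_rot _ (wd_ne s L i)
  intro p hp hpl
  rw [← List.rotate_eq_drop_append_take hpl.le]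
  have h1 : rr s L i < rr s L (s^[p] i) := by
    refine lt_of_le_of_ne (rr_mono s L hm hs (hi p)) fun h => ?_
    have h2 := fix_of_eq s L hm hs i p h.symm
    rw [wd_length] at hpl
    exact Function.not_isPeriodicPt_of_pos_of_lt_minimalPeriod hp.ne' hpl h2
  rw [lt_iff _ _ (by simp)]
  rw [rr, rr, wd_rotate, rho, rho, List.length_rotate,
    div_lt_div_iff_of_pos_right (den_pos _ (wd_ne s L i))] at h1
  exact h1


open Classical in
/-- minimal elements of the cycles, in decreasing order -/
noncomputable def reps : List (Fin n) :=
  ((List.finRange n).reverse).filter fun i => ∀ p, i ≤ s^[p] i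

/-- the list of all rows, cycle by cycle -/
noncomputable def orb (i : Fin n) : List (Fin n) := (List.range (Function.minimalPeriod s i)).map fun t => s^[t] i

theorem back (i : Fin n) (t : ℕ) : ∃ v, s^[v] (s^[t] i) = i := by
  refine ⟨t * Function.minimalPeriod s i - t, ?_⟩
  rw [← Function.iterate_add_apply, Nat.sub_add_cancel (Nat.le_mul_of_pos_right _ (per_pos s i))]
  exact (Function.isPeriodicPt_minimalPeriod s i).const_mul t

theorem mem_reps (i : Fin n) : i ∈ reps s ↔ ∀ p, i ≤ s^[p] i := by
  simp [reps]

theorem mem_orb (i : Fin n) (p : ℕ) : s^[p] i ∈ orb s i := by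
  unfold orb
  rw [List.mem_map]
  exact ⟨p % Function.minimalPeriod s i, by simpa using Nat.mod_lt _ (per_pos s i),
    Function.iterate_mod_minimalPeriod_eq⟩

theorem exists_rep (i : Fin n) : ∃ m ∈ reps s, ∃ p, s^[p] m = i := by
  obtain ⟨m, ⟨p, hp⟩, hmin⟩ := (Set.toFinite {j | ∃ p, s^[p] i = j}).exists_minimal ⟨i, 0, rfl⟩
  refine ⟨m, (mem_reps s m).2 fun q => ?_, ?_⟩
  · have : s^[q] m ∈ {j | ∃ p, s^[p] i = j} :=
      ⟨q + p, by rw [Function.iterate_add_apply, hp]⟩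
    rcases le_total m (s^[q] m) with h | h
    · exact h
    · exact hmin this h
  · rw [← hp]; exact back s i p

theorem reps_sorted : (reps s).Pairwise (fun a b => b < a) := by
  unfold reps
  apply List.Pairwise.filter
  rw [List.pairwise_reverse]
  exact List.pairwise_lt_finRange n

theorem orb_perm : ((reps s).flatMap (orb s)).Perm (List.finRange n) := by
  rw [List.perm_ext_iff_of_nodup _ (List.nodup_finRange n)]
  · intro i
    simp only [List.mem_flatMap, List.mem_finRange, iff_true]
    obtain ⟨m, hm, p, rfl⟩ := exists_rep s i
    exact ⟨m, hm, mem_orb s m p⟩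
  · rw [List.nodup_flatMap]
    constructor
    · intro i _
      unfold orb
      apply List.Nodup.map_on _ List.nodup_range
      intro x hx y hy h
      rw [List.mem_range] at hx hy
      exact (Function.iterate_eq_iterate_iff_of_lt_minimalPeriod hx hy).1 h
    · apply (reps_sorted s).imp_of_mem
      intro i j hi hj hij
      rw [mem_reps] at hi hj
      simp only [Function.onFun, List.Disjoint, orb, List.mem_map]
      rintro _ ⟨t, _, rfl⟩ ⟨u, _, hu⟩
      obtain ⟨v, hv⟩ := back s i t
      rw [← hu, ← Function.iterate_add_apply] at hv
      have := hj (v + u)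
      obtain ⟨v', hv'⟩ := back s j u
      rw [hu, ← Function.iterate_add_apply] at hv'
      have := hi (v' + t)
      rw [hv'] at this
      exact absurd this (not_le.2 hij)

/-- the constructed factorization -/
noncomputable def facs : List (List Bool) := (reps s).map (wd s L)

theorem facs_flatten : (facs s L).flatten = ((reps s).flatMap (orb s)).map (fun i => L (s i)) := by
  simp only [facs, List.flatMap_def, List.map_flatten, List.map_map]
  congr 1
  apply List.map_congr_left
  intro i _
  simp only [Function.comp_apply, wd, orb, List.map_map]
  rfl

theorem facs_rotations : (facs s L).flatMap rotations = ((reps s).flatMap (orb s)).map (wd s L) := by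
  simp only [facs, List.flatMap_def, List.map_flatten, List.map_map]
  congr 1
  apply List.map_congr_left
  intro i _
  simp only [Function.comp_apply, wd_rotations, orb, List.map_map]
  rfl

theorem facs_perm : (facs s L).flatten.Perm (List.ofFn L) := by
  rw [facs_flatten]
  refine ((orb_perm s).map _).trans ?_
  rw [← List.ofFn_eq_map]
  exact s.ofFn_comp_perm L


theorem facs_lyndon
    (hm : Monotone (L ∘ s)) (hs : ∀ i j, i < j → L (s i) = L (s j) → s i < s j) : ∀ f ∈ facs s L, IsLyndon f := by
  intro f hf
  obtain ⟨i, hi, rfl⟩ := List.mem_map.1 hf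
  exact wd_lyndon s L hm hs i ((mem_reps s i).1 hi)

theorem facs_sorted
    (hm : Monotone (L ∘ s)) (hs : ∀ i j, i < j → L (s i) = L (s j) → s i < s j) : (facs s L).Pairwise (fun a b => b ≤ a) := by
  unfold facs
  rw [List.pairwise_map]
  apply (reps_sorted s).imp_of_mem
  intro i j hi hj hij
  exact le_of_omega _ _ (wd_lyndon s L hm hs j ((mem_reps s j).1 hj)) (wd_ne s L i)
    ((omega_wd s L j i).2 (rr_mono s L hm hs hij.le))

theorem facs_sort
    (hm : Monotone (L ∘ s)) (hs : ∀ i j, i < j → L (s i) = L (s j) → s i < s j) : List.insertionSort omegaLE ((facs s L).flatMap rotations) =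
    (List.finRange n).map (wd s L) := by
  classical
  let r : Fin n → Fin n → Prop := fun i j => rr s L i ≤ rr s L j
  have : Std.Total r := ⟨fun i j => le_total _ _⟩
  have : IsTrans (Fin n) r := ⟨fun i j k h1 h2 => le_trans h1 h2⟩
  rw [facs_rotations, ← List.map_insertionSort (r := r) (s := omegaLE) (wd s L) _
    (fun a _ b _ => (omega_wd s L a b).symm)]
  apply List.Perm.eq_of_pairwise (le := omegaLE)
  · intro a b ha hb h1 h2
    obtain ⟨i, _, rfl⟩ := List.mem_map.1 ha
    obtain ⟨j, _, rfl⟩ := List.mem_map.1 hb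
    exact wd_eq s L hm hs i j (le_antisymm ((omega_wd s L i j).1 h1) ((omega_wd s L j i).1 h2))
  · rw [List.pairwise_map]
    exact (List.pairwise_insertionSort r _).imp fun {a b} h => (omega_wd s L a b).2 h
  · rw [List.pairwise_map]
    exact (List.pairwise_lt_finRange n).imp
      fun {a b} h => (omega_wd s L a b).2 (rr_mono s L hm hs h.le)
  · exact ((List.perm_insertionSort r _).trans (orb_perm s)).map _

theorem facs_bbwt
    (hm : Monotone (L ∘ s)) (hs : ∀ i j, i < j → L (s i) = L (s j) → s i < s j) : BBWTof (facs s L) = List.ofFn L := by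
  unfold BBWTof
  rw [facs_sort s L hm hs, List.flatMap_map, List.ofFn_eq_map]
  simp only [wd_last]
  exact (List.map_eq_flatMap).symm


theorem run_pos
    (hm : Monotone (L ∘ s)) (hs : ∀ i j, i < j → L (s i) = L (s j) → s i < s j) (j : ℕ) (hj : j < n) (hlast : ∀ q : Fin n, q.1 = n - 1 → L q = false)
    (hrun : ∀ q : Fin n, n - 1 - j ≤ q.1 → q.1 < n - 1 → L q = true) (q : ℕ) (hq : q < j)
    (i : Fin n) (hi : i.1 = n - 1 - q) : (s i).1 = n - 2 - q := by
  induction q using Nat.strong_induction_on generalizing i with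
  | _ q ih =>
    obtain ⟨y, hy⟩ := s.surjective ⟨n - 2 - q, by omega⟩
    have hLy : L (s y) = true := by rw [hy]; exact hrun _ (by simp; omega) (by simp; omega)
    have hyi : y ≤ i := by
      by_contra hc
      have hc' : i.1 < y.1 := not_le.1 hc
      have hyn := y.2
      have := ih (n - 1 - y.1) (by omega) (by omega) y (by omega)
      rw [hy] at this
      simp only at this
      omega
    rcases hyi.lt_or_eq with h | h
    · exfalso
      have hLi : L (s i) = true := by
        have h1 : L (s y) ≤ L (s i) := hm hyi
        rw [hLy] at h1
        exact top_le_iff.1 h1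
      have h2 := hs y i h (by rw [hLy, hLi])
      rw [hy] at h2
      have h3 : n - 2 - q < (s i).1 := h2
      have h4 := (s i).2
      by_cases h5 : (s i).1 = n - 1
      · rw [hlast _ h5] at hLi; exact absurd hLi (by decide)
      · have h6 := ih (n - 2 - (s i).1) (by omega) (by omega) ⟨n - 1 - (n - 2 - (s i).1), by omega⟩ rfl
        have h7 : s ⟨n - 1 - (n - 2 - (s i).1), by omega⟩ = s i := by
          apply Fin.ext; rw [h6]; omega
        have h8 := congrArg Fin.val (s.injective h7)
        simp only at h8
        omega
    · rw [← h, hy]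

theorem run_true
    (hm : Monotone (L ∘ s)) (hs : ∀ i j, i < j → L (s i) = L (s j) → s i < s j) (j : ℕ) (hj : j < n) (hlast : ∀ q : Fin n, q.1 = n - 1 → L q = false)
    (hrun : ∀ q : Fin n, n - 1 - j ≤ q.1 → q.1 < n - 1 → L q = true)
    (hex : ∃ q : Fin n, q.1 < n - 1 - j ∧ L q = true)
    (q : ℕ) (hq : q ≤ j) (i : Fin n) (hi : i.1 = n - 1 - q) : L (s i) = true := by
  obtain ⟨e, he, hLe⟩ := hex
  obtain ⟨y, rfl⟩ := s.surjective e
  have hyi : y ≤ i := by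
    by_contra hc
    have hc' : i.1 < y.1 := not_le.1 hc
    have hyn := y.2
    have := run_pos s L hm hs j hj hlast hrun (n - 1 - y.1) (by omega) y (by omega)
    omega
  have h1 : L (s y) ≤ L (s i) := hm hyi
  rw [hLe] at h1
  exact top_le_iff.1 h1

theorem facs_run
    (hm : Monotone (L ∘ s)) (hs : ∀ i j, i < j → L (s i) = L (s j) → s i < s j) (j : ℕ) (hj : j < n) (hlast : ∀ q : Fin n, q.1 = n - 1 → L q = false)
    (hrun : ∀ q : Fin n, n - 1 - j ≤ q.1 → q.1 < n - 1 → L q = true)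
    (hex : ∃ q : Fin n, q.1 < n - 1 - j ∧ L q = true) :
    ∃ l r, (facs s L).flatten = l ++ List.replicate (j + 1) true ++ r := by
  obtain ⟨z, hz⟩ : ∃ z : Fin n, z.1 = n - 1 := ⟨⟨n - 1, by omega⟩, rfl⟩
  have hit : ∀ q, q ≤ j → (s^[q] z).1 = n - 1 - q := by
    intro q
    induction q with
    | zero => intro _; simpa using hz
    | succ q ih =>
      intro hq
      rw [Function.iterate_succ_apply', run_pos s L hm hs j hj hlast hrun q (by omega) _ (ih (by omega))]
      omega
  have htr : ∀ q, q ≤ j → L (s (s^[q] z)) = true := fun q hq =>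
    run_true s L hm hs j hj hlast hrun hex q hq _ (hit q hq)
  obtain ⟨m, hmr, p', hp'⟩ := exists_rep s z
  have hc := per_pos s m
  obtain ⟨p, hpc, hp⟩ : ∃ p, p < Function.minimalPeriod s m ∧ s^[p] m = z :=
    ⟨p' % Function.minimalPeriod s m, Nat.mod_lt _ hc,
      by rw [Function.iterate_mod_minimalPeriod_eq, hp']⟩
  have hLm : L (s m) = false := by
    have h1 : L (s m) ≤ L (s (s^[p + Function.minimalPeriod s m - 1] m)) :=
      hm ((mem_reps s m).1 hmr _)
    rw [← Function.iterate_succ_apply' s,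
      show (p + Function.minimalPeriod s m - 1).succ = p + Function.minimalPeriod s m by omega,
      Function.iterate_add_minimalPeriod_eq, hp, hlast z hz] at h1
    exact le_bot_iff.1 h1
  have hadd : ∀ q, s^[p + q] m = s^[q] z := by
    intro q; rw [add_comm, Function.iterate_add_apply, hp]
  have hlen : ∀ q, q ≤ j → p + q < Function.minimalPeriod s m := by
    intro q
    induction q with
    | zero => intro _; simpa using hpc
    | succ q ih =>
      intro hq
      have h1 := ih (by omega)
      by_contra hcon
      have h2 : p + (q + 1) = Function.minimalPeriod s m := by omega
      have h3 := hadd (q + 1)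
      rw [h2, Function.iterate_minimalPeriod] at h3
      have h4 := htr (q + 1) hq
      rw [← h3, hLm] at h4
      exact absurd h4 (by decide)
  have hw : ((wd s L m).drop p).take (j + 1) = List.replicate (j + 1) true := by
    apply List.ext_getElem
    · have := hlen j le_rfl
      simp [wd_length]; omega
    · intro q h1 h2
      simp only [List.length_replicate] at h2
      simp only [List.getElem_take, List.getElem_drop, List.getElem_replicate, wd,
        List.getElem_map, List.getElem_range]
      rw [hadd]; exact htr q (by omega)
  have hmem : wd s L m ∈ facs s L := List.mem_map_of_mem hmr
  obtain ⟨A, C, hAC⟩ := List.append_of_mem hmem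
  refine ⟨A.flatten ++ (wd s L m).take p, ((wd s L m).drop p).drop (j + 1) ++ C.flatten, ?_⟩
  rw [hAC, ← hw]
  simp only [List.flatten_append, List.flatten_cons, List.append_assoc]
  rw [← List.append_assoc (List.take (j+1) _), List.take_append_drop,
    ← List.append_assoc (List.take p _), List.take_append_drop]

end orbit

theorem inv_exists (v : List Bool) : ∃ fs : List (List Bool),
    (∀ f ∈ fs, IsLyndon f) ∧ fs.Pairwise (fun a b => b ≤ a) ∧ BBWTof fs = v ∧ fs.flatten.Perm v ∧
    ∀ j w, v = w ++ List.replicate j true ++ [false] → true ∈ w →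
      ∃ l r, fs.flatten = l ++ List.replicate (j + 1) true ++ r := by
  obtain ⟨hm, hs⟩ := Tuple.eq_sort_iff.1 (rfl : Tuple.sort v.get = Tuple.sort v.get)
  refine ⟨facs (Tuple.sort v.get) v.get, facs_lyndon _ _ hm hs, facs_sorted _ _ hm hs, ?_, ?_, ?_⟩
  · rw [facs_bbwt _ _ hm hs, List.ofFn_get]
  · have := facs_perm (Tuple.sort v.get) v.get
    rwa [List.ofFn_get] at this
  · intro j w hv hw
    have hl : v.length = w.length + j + 1 := by rw [hv]; simp; omega
    apply facs_run _ _ hm hs j (by omega)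
    · intro q hq
      simp only [List.get_eq_getElem, hq, hv, List.getElem_append]
      simp
    · intro q h1 h2
      simp only [List.get_eq_getElem, hv, List.getElem_append]
      simp; grind
    · obtain ⟨i, hi, hiw⟩ := List.getElem_of_mem hw
      refine ⟨⟨i, by omega⟩, by simp; omega, ?_⟩
      simp only [List.get_eq_getElem, hv]
      simp only [List.append_assoc]
      rw [List.getElem_append_left hi, hiw]

/-- the inverse transform, factor list -/
noncomputable def Gf (v : List Bool) : List (List Bool) := (inv_exists v).choose

/-- the inverse transform -/
noncomputable def G (v : List Bool) : List Bool := (Gf v).flatten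

theorem G_inj (v v' : List Bool) (h : G v = G v') : v = v' := by
  have a := (inv_exists v).choose_spec
  have a' := (inv_exists v').choose_spec
  have := fac_unique (Gf v) (Gf v') a.1 a'.1 a.2.1 a'.2.1 h
  rw [← a.2.2.1, ← a'.2.2.1]
  exact congrArg BBWTof this

theorem G_perm (v : List Bool) : (G v).Perm v := (inv_exists v).choose_spec.2.2.2.1

theorem G_step (v : List Bool) : BBWTRotStep (G v) v := by
  have a := (inv_exists v).choose_spec
  exact Or.inr ⟨Gf v, ⟨rfl, a.1, a.2.1.isChain⟩, a.2.2.1.symm⟩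

theorem G_back (v : List Bool) : Relation.ReflTransGen BBWTRotStep v (G v) := by
  let g : List.Vector Bool v.length → List.Vector Bool v.length :=
    fun x => ⟨G x.1, by rw [(G_perm x.1).length_eq, x.2]⟩
  have hg : Function.Injective g := by
    intro x y h
    exact Subtype.ext (G_inj _ _ (congrArg Subtype.val h))
  obtain ⟨N, hN, hper⟩ := hg.mem_periodicPts ⟨v, rfl⟩
  have key : ∀ (k : ℕ) (x : List.Vector Bool v.length),
      Relation.ReflTransGen BBWTRotStep (g^[k] x).1 x.1 := by
    intro k
    induction k with
    | zero => intro x; exact Relation.ReflTransGen.refl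
    | succ k ih =>
      intro x
      rw [Function.iterate_succ_apply']
      exact Relation.ReflTransGen.head (G_step _) (ih x)
  obtain ⟨M, rfl⟩ : ∃ M, N = M + 1 := ⟨N - 1, by omega⟩
  have h := key M (g ⟨v, rfl⟩)
  have h2 : g^[M] (g ⟨v, rfl⟩) = ⟨v, rfl⟩ := hper
  rw [h2] at h
  exact h

theorem rot_reach (u v : List Bool) : Relation.ReflTransGen BBWTRotStep (u ++ v) (v ++ u) := by
  induction v using List.reverseRecOn generalizing u with
  | nil => simpa using Relation.ReflTransGen.refl
  | append_singleton v a ih =>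
    have h1 : BBWTRotStep (u ++ (v ++ [a])) ((a :: u) ++ v) := by
      left
      unfold rotR
      rw [← List.append_assoc, List.length_append, List.length_singleton, Nat.add_sub_cancel,
        List.drop_left, List.take_left]
      simp
    have := Relation.ReflTransGen.head h1 (ih (a :: u))
    simpa using this

/-- mutual reachability -/
def E (x y : List Bool) : Prop :=
  Relation.ReflTransGen BBWTRotStep x y ∧ Relation.ReflTransGen BBWTRotStep y x ∧ x.Perm y

theorem E.trans {x y z : List Bool} (h : E x y) (h' : E y z) : E x z :=
  ⟨h.1.trans h'.1, h'.2.1.trans h.2.1, h.2.2.trans h'.2.2⟩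

theorem E_rot (u v : List Bool) : E (u ++ v) (v ++ u) :=
  ⟨rot_reach u v, rot_reach v u, List.perm_append_comm⟩

theorem E_G (v : List Bool) : E v (G v) :=
  ⟨G_back v, Relation.ReflTransGen.single (G_step v), (G_perm v).symm⟩

theorem E_run (x : List Bool) (j : ℕ) (hj : j ≤ x.count true) :
    ∃ w, E x (List.replicate j true ++ w) := by
  induction j with
  | zero => exact ⟨x, by simpa using ⟨Relation.ReflTransGen.refl, Relation.ReflTransGen.refl, List.Perm.refl _⟩⟩
  | succ j ih =>
    obtain ⟨w, hw⟩ := ih (by omega)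
    have hcount := hw.2.2.count_eq true
    rw [List.count_append, List.count_replicate_self] at hcount
    cases w with
    | nil => simp at hcount; omega
    | cons c w =>
      cases c with
      | true =>
        refine ⟨w, ?_⟩
        rw [List.replicate_succ', List.append_assoc]
        exact hw
      | false =>
        have hmem : true ∈ w := by
          rw [← List.count_pos_iff]
          simp at hcount; omega
        have h1 := E_rot (List.replicate j true ++ [false]) w
        rw [List.append_assoc, List.singleton_append] at h1
        have h2 := hw.trans (h1.trans (E_G _))
        obtain ⟨l, r, hlr⟩ := (inv_exists (w ++ (List.replicate j true ++ [false]))).choose_spec.2.2.2.2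
          j w (by simp) hmem
        have hG : G (w ++ (List.replicate j true ++ [false])) = l ++ (List.replicate (j+1) true ++ r) := by
          rw [← List.append_assoc l]; exact hlr
        rw [hG] at h2
        refine ⟨r ++ l, ?_⟩
        rw [← List.append_assoc]
        exact h2.trans (E_rot _ _)

theorem E_canon (x : List Bool) :
    E x (List.replicate (x.count true) true ++ List.replicate (x.count false) false) := by
  obtain ⟨w, hw⟩ := E_run x _ le_rfl
  have h1 := hw.2.2.count_eq true
  have h2 := hw.2.2.count_eq false
  have hwf : ∀ b ∈ w, b = false := by
    intro b hb
    by_contra hc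
    have hb' : b = true := by simpa using hc
    subst hb'
    have := List.count_pos_iff.2 hb
    simp at h1; omega
  have hw' := List.eq_replicate_of_mem hwf
  have : w.length = x.count false := by
    rw [h2, hw']; simp [List.count_replicate]
  rw [this] at hw'
  rwa [hw'] at hw

end BB

/-- Over the binary alphabet `{a, b}` with `a ≺ b` (encoded as `Bool` with
`a = false` and `b = true`), any two strings with the same length and the same
Parikh vector (i.e. permutations of each other) can be transformed into each
other by a finite composition of `rot` and `BBWT` operations. -/
theorem reachable_of_perm_binary (x y : List Bool) (h : x.Perm y) :
    Relation.ReflTransGen BBWTRotStep x y := by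
  have hx := BB.E_canon x
  have hy := BB.E_canon y
  rw [← h.count_eq true, ← h.count_eq false] at hy
  exact hx.1.trans hy.2.1
end

section
/- Let x and y be two strings of the same length n in which every symbol occurs exactly once (i.e., both are sequences of n pairwise distinct symbols) and which have the same Parikh vector (they are permutations of the same set of n symbols). Then there is a finite composition of the operations rot and BBWT that maps x to y. -/
open List

variable {α : Type*} [LinearOrder α]

/-- Pairs (letter, cyclic predecessor), going along a factor. -/
def cycPairs (f p : α) : List α → List (α × α)
  | [] => [(f, p)]
  | y :: t => (y, p) :: cycPairs f y t

def insAfter (b n : α) (l : List α) : List α :=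
  l.flatMap fun x => if x = b then [x, n] else [x]

def insFactor (b n : α) (p : α × List α) : α × List α :=
  (p.1, (if p.1 = b then [n] else []) ++ insAfter b n p.2)

def fword (fs : List (α × List α)) : List α := fs.flatMap fun p => p.1 :: p.2

def fpairs (fs : List (α × List α)) : List (α × α) := fs.flatMap fun p => cycPairs p.1 p.1 p.2

def GoodF (fs : List (α × List α)) : Prop :=
  (∀ p ∈ fs, ∀ y ∈ p.2, p.1 < y) ∧ fs.Pairwise (fun p q => q.1 < p.1)

def GoodB (w u : List α) : Prop :=
  ∃ fs P, GoodF fs ∧ fword fs = w ∧ P ~ fpairs fs ∧ P.Pairwise (fun a b : α × α => a.1 < b.1) ∧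
    u = P.map Prod.snd

theorem cycPairs_perm (f p : α) (t : List α) :
    cycPairs f p t ~ (f, t.getLastD p) :: zip t (p :: t) := by
  induction t generalizing p with
  | nil => simp [cycPairs]
  | cons y t ih =>
    simp only [cycPairs, getLastD_cons, zip_cons_cons]
    exact ((ih y).cons _).trans (Perm.swap _ _ _)

theorem cycPairs_fst (f p : α) (t : List α) : (cycPairs f p t).map Prod.fst ~ f :: t := by
  induction t generalizing p with
  | nil => simp [cycPairs]
  | cons y t ih =>
    simp only [cycPairs, map_cons]
    exact ((ih y).cons _).trans (Perm.swap _ _ _)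

theorem cycPairs_snd (f p : α) (t : List α) : (cycPairs f p t).map Prod.snd = p :: t := by
  induction t generalizing p with
  | nil => simp [cycPairs]
  | cons y t ih => simp [cycPairs, ih]

theorem fpairs_fst (fs : List (α × List α)) : (fpairs fs).map Prod.fst ~ fword fs := by
  induction fs with
  | nil => simp [fpairs, fword]
  | cons p fs ih =>
    simp only [fpairs, fword, flatMap_cons, map_append] at ih ⊢
    exact (cycPairs_fst _ _ _).append ih

theorem fpairs_snd (fs : List (α × List α)) : (fpairs fs).map Prod.snd = fword fs := by
  induction fs with
  | nil => simp [fpairs, fword]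
  | cons p fs ih =>
    simp only [fpairs, fword, flatMap_cons, map_append] at ih ⊢
    rw [cycPairs_snd, ih]

theorem cycPairs_ins (f p b n : α) (t : List α) :
    cycPairs f p ((if p = b then [n] else []) ++ insAfter b n t) ~
      (cycPairs f p t).map (fun z => (z.1, if z.2 = b then n else z.2)) ++
        replicate (count b (p :: t)) (n, b) := by
  induction t generalizing p with
  | nil =>
    by_cases h : p = b
    · subst h; simp [insAfter, cycPairs]; exact Perm.swap _ _ _
    · simp [insAfter, cycPairs, h]
  | cons y t ih =>
    have e : insAfter b n (y :: t) = y :: ((if y = b then [n] else []) ++ insAfter b n t) := by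
      simp only [insAfter, flatMap_cons]
      split_ifs <;> simp
    have key := ih y
    by_cases h : p = b
    · subst h
      rw [e]
      simp only [if_true, cons_append, nil_append, cycPairs, map_cons, count_cons_self,
        replicate_succ]
      refine (Perm.swap _ _ _).trans (Perm.cons _ ?_)
      exact (key.cons _).trans perm_middle.symm
    · rw [e]
      simp only [h, if_false, nil_append, cycPairs, map_cons, cons_append]
      rw [count_cons_of_ne h]
      exact key.cons _

theorem fword_ins (b n : α) (fs : List (α × List α)) :
    fword (fs.map (insFactor b n)) = insAfter b n (fword fs) := by
  induction fs with
  | nil => simp [fword, insAfter]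
  | cons p fs ih =>
    simp only [fword, insAfter, insFactor, map_cons, flatMap_cons, flatMap_append] at ih ⊢
    rw [ih]
    split_ifs <;> simp

theorem fpairs_ins (b n : α) (fs : List (α × List α)) :
    fpairs (fs.map (insFactor b n)) ~
      (fpairs fs).map (fun z => (z.1, if z.2 = b then n else z.2)) ++
        replicate (count b (fword fs)) (n, b) := by
  induction fs with
  | nil => simp [fpairs, fword]
  | cons p fs ih =>
    simp only [fpairs, fword, map_cons, flatMap_cons, map_append, count_append,
      replicate_add] at ih ⊢
    refine ((cycPairs_ins p.1 p.1 b n p.2).append ih).trans ?_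
    simp only [append_assoc]
    refine Perm.append_left _ ?_
    simp only [← append_assoc]
    exact Perm.append_right _ perm_append_comm

theorem GoodB.perm {w u : List α} (h : GoodB w u) : u ~ w := by
  obtain ⟨fs, P, _, rfl, h3, _, rfl⟩ := h
  rw [← fpairs_snd]
  exact h3.map _

theorem GoodB.consMax {w u : List α} {m : α} (h : GoodB w u) (hm : ∀ a ∈ w, a < m) :
    GoodB (m :: w) (u ++ [m]) := by
  obtain ⟨fs, P, h1, rfl, h3, h4, rfl⟩ := h
  refine ⟨(m, []) :: fs, P ++ [(m, m)], ⟨?_, ?_⟩, ?_, ?_, ?_, ?_⟩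
  · intro p hp
    rcases mem_cons.1 hp with rfl | hp
    · simp
    · exact h1.1 p hp
  · refine pairwise_cons.2 ⟨fun q hq => hm _ ?_, h1.2⟩
    exact mem_flatMap.2 ⟨q, hq, by simp⟩
  · simp [fword]
  · simp only [fpairs, flatMap_cons, cycPairs]
    exact perm_append_comm.trans (h3.append_left _)
  · refine pairwise_append.2 ⟨h4, by simp, ?_⟩
    intro a ha b hb
    simp only [mem_singleton] at hb
    subst hb
    exact hm _ ((fpairs_fst fs).subset (mem_map_of_mem (h3.subset ha)))
  · simp

theorem GoodB.insMax {w u : List α} {b m : α} (h : GoodB w u) (hw : w.Nodup) (hb : b ∈ w)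
    (hm : ∀ a ∈ w, a < m) :
    GoodB (insAfter b m w) (u.map (fun y => if y = b then m else y) ++ [b]) := by
  obtain ⟨fs, P, h1, rfl, h3, h4, rfl⟩ := h
  refine ⟨fs.map (insFactor b m), P.map (fun z => (z.1, if z.2 = b then m else z.2)) ++ [(m, b)],
    ⟨?_, ?_⟩, ?_, ?_, ?_, ?_⟩
  · intro p hp y hy
    obtain ⟨q, hq, rfl⟩ := mem_map.1 hp
    have hqm : q.1 < m := hm _ (mem_flatMap.2 ⟨q, hq, by simp⟩)
    have := h1.1 q hq
    simp only [insFactor, insAfter, mem_append, mem_flatMap] at hy ⊢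
    rcases hy with hy | ⟨a, ha, hy⟩
    · split_ifs at hy
      · simp at hy; subst hy; exact hqm
      · simp at hy
    · split_ifs at hy
      · simp at hy; rcases hy with rfl | rfl
        · exact this _ ha
        · exact hqm
      · simp at hy; subst hy; exact this _ ha
  · exact pairwise_map.2 h1.2
  · exact fword_ins _ _ _
  · refine Perm.trans ?_ (fpairs_ins b m fs).symm
    rw [count_eq_one_of_mem hw hb]
    exact (h3.map _).append_right _
  · refine pairwise_append.2 ⟨pairwise_map.2 h4, by simp, ?_⟩
    intro a ha c hc
    simp only [mem_singleton] at hc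
    subst hc
    obtain ⟨q, hq, rfl⟩ := mem_map.1 ha
    have : q.1 ∈ fword fs := (fpairs_fst fs).subset (mem_map_of_mem (h3.subset hq))
    exact hm _ this
  · simp

theorem fword_inj : ∀ (fs gs : List (α × List α)), GoodF fs → GoodF gs → fword fs = fword gs →
    fs = gs
  | [], [], _, _, _ => rfl
  | [], q :: gs, _, _, h => by simp [fword] at h
  | p :: fs, [], _, _, h => by simp [fword] at h
  | (h, t) :: fs, (k, s) :: gs, hf, hg, e => by
    have tw : ∀ (h : α) (t : List α) (fs : List (α × List α)), GoodF ((h, t) :: fs) →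
        (t ++ fword fs).takeWhile (fun y => decide (h < y)) = t ∧
        (t ++ fword fs).dropWhile (fun y => decide (h < y)) = fword fs := by
      intro h t fs hf
      have h1 : ∀ y ∈ t, decide (h < y) = true := fun y hy => by
        simpa using hf.1 (h, t) (by simp) y hy
      rw [takeWhile_append_of_pos h1, dropWhile_append_of_pos h1]
      cases fs with
      | nil => simp [fword]
      | cons q fs =>
        have : q.1 < h := (pairwise_cons.1 hf.2).1 q (by simp)
        simp [fword, this.le]
    simp only [fword, flatMap_cons, cons_append, cons.injEq] at e
    obtain ⟨rfl, e⟩ := e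
    have a := tw h t fs hf
    have b := tw h s gs hg
    simp only [fword] at a b
    rw [e] at a
    have e1 : t = s := a.1.symm.trans b.1
    have e2 : fword fs = fword gs := a.2.symm.trans b.2
    have := fword_inj fs gs ⟨fun p hp => hf.1 p (mem_cons_of_mem _ hp), (pairwise_cons.1 hf.2).2⟩
      ⟨fun p hp => hg.1 p (mem_cons_of_mem _ hp), (pairwise_cons.1 hg.2).2⟩ e2
    rw [e1, this]

theorem sorted_pairs_unique {P Q : List (α × α)} (h : P ~ Q)
    (hP : P.Pairwise (fun a b : α × α => a.1 < b.1))
    (hQ : Q.Pairwise (fun a b : α × α => a.1 ≤ b.1)) : P = Q := by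
  have hn : (P.map Prod.fst).Nodup := pairwise_map.2 (hP.imp fun h => h.ne)
  refine h.eq_of_pairwise ?_ (hP.imp fun h => h.le) hQ
  intro a b ha hb h1 h2
  exact inj_on_of_nodup_map hn ha (h.symm.subset hb) (le_antisymm h1 h2)

theorem GoodB.det {w u v : List α} (h : GoodB w u) (h' : GoodB w v) : u = v := by
  obtain ⟨fs, P, h1, rfl, h3, h4, rfl⟩ := h
  obtain ⟨gs, Q, g1, g2, g3, g4, rfl⟩ := h'
  obtain rfl := fword_inj _ _ g1 h1 g2
  rw [sorted_pairs_unique (h3.trans g3.symm) h4 (g4.imp fun h => h.le)]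

/-- existence of a maximum, removed from the list -/
theorem exists_max_mem (l : List α) (hl : l ≠ []) : ∃ m ∈ l, ∀ a ∈ l, a ≤ m := by
  induction l with
  | nil => exact absurd rfl hl
  | cons a l ih =>
    by_cases h : l = []
    · subst h; exact ⟨a, by simp⟩
    · obtain ⟨m, hm, hm'⟩ := ih h
      rcases le_total a m with h | h
      · exact ⟨m, by simp [hm], by simpa [h] using hm'⟩
      · exact ⟨a, by simp, by simpa using fun x hx => (hm' x hx).trans h⟩

theorem insAfter_of_not_mem {b m : α} {l : List α} (h : b ∉ l) : insAfter b m l = l := by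
  induction l with
  | nil => rfl
  | cons a l ih =>
    simp only [mem_cons, not_or] at h
    have := ih h.2
    simp only [insAfter, flatMap_cons] at this ⊢
    rw [this, if_neg (Ne.symm h.1)]; rfl

theorem insAfter_append (b m : α) (l l' : List α) :
    insAfter b m (l ++ l') = insAfter b m l ++ insAfter b m l' := by simp [insAfter]

theorem insAfter_getLast? (b m : α) (l : List α) :
    (insAfter b m l).getLast? = l.getLast?.map (fun y => if y = b then m else y) := by
  rcases eq_nil_or_concat' l with rfl | ⟨l, a, rfl⟩
  · rfl
  · rw [insAfter_append]
    simp only [insAfter, flatMap_cons, flatMap_nil, append_nil]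
    split_ifs with h <;> simp [h]

theorem GoodB.surj (n : ℕ) : ∀ u : List α, u.length = n → u.Nodup →
    ∃ w, GoodB w u ∧ u.head? = w.getLast? := by
  induction n with
  | zero =>
    intro u hu _
    obtain rfl := length_eq_zero_iff.1 hu
    exact ⟨[], ⟨[], [], by simp [GoodF], by simp [fword], by simp [fpairs], by simp, by simp⟩, rfl⟩
  | succ n ih =>
    intro u hu hn
    have hne : u ≠ [] := by rintro rfl; simp at hu
    obtain ⟨m, hm, hmax⟩ := exists_max_mem u hne
    rcases eq_nil_or_concat' u with rfl | ⟨u, c, rfl⟩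
    · exact absurd rfl hne
    have hn' := nodup_append.1 hn
    have hcu : c ∉ u := fun h => hn'.2.2 c h c (by simp) rfl
    have hlen : u.length = n := by simpa using hu
    by_cases hc : c = m
    · subst hc
      obtain ⟨w, h1, h2⟩ := ih u hlen hn'.1
      refine ⟨c :: w, h1.consMax ?_, ?_⟩
      · intro a ha
        have ha := h1.perm.symm.subset ha
        exact lt_of_le_of_ne (hmax a (by simp [ha])) (by rintro rfl; exact hcu ha)
      · cases u with
        | nil =>
          have : w = [] := by simpa using h1.perm
          subst this; simp
        | cons x v =>
          simp only [head?_cons] at h2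
          simp [getLast?_cons, ← h2]
    · have hmu : m ∈ u := by
        simpa [Ne.symm hc] using hm
      have hinj : (u.map (fun y => if y = m then c else y)).Nodup := by
        refine hn'.1.map_on ?_
        intro a ha b hb hab
        have hac : a ≠ c := by rintro rfl; exact hcu ha
        have hbc : b ≠ c := by rintro rfl; exact hcu hb
        split_ifs at hab with h1 h2 h2
        · rw [h1, h2]
        · exact absurd hab.symm hbc
        · exact absurd hab hac
        · exact hab
      obtain ⟨w, h1, h2⟩ := ih _ (by simpa using hlen) hinj
      have hmem : ∀ a ∈ w, a < m := by
        intro a ha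
        have ha := h1.perm.symm.subset ha
        obtain ⟨y, hy, rfl⟩ := mem_map.1 ha
        split_ifs with h
        · exact lt_of_le_of_ne (hmax c (by simp)) hc
        · exact lt_of_le_of_ne (hmax y (by simp [hy])) h
      have hcw : c ∈ w := h1.perm.subset (mem_map.2 ⟨m, hmu, by simp⟩)
      have h3 := h1.insMax (h1.perm.nodup_iff.1 hinj) hcw hmem
      have e : (u.map (fun y => if y = m then c else y)).map (fun y => if y = c then m else y)
          = u := by
        rw [map_map]
        conv_rhs => rw [← map_id u]
        refine map_congr_left fun y hy => ?_
        have hyc : y ≠ c := by rintro rfl; exact hcu hy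
        by_cases h : y = m
        · simp [h]
        · simp [h, hyc]
      rw [e] at h3
      refine ⟨_, h3, ?_⟩
      rw [insAfter_getLast?, ← h2, ← head?_map, e]
      cases u with
      | nil => simp at hmu
      | cons => simp

def GStep (u v : List α) : Prop := (∃ x t, u = t ++ [x] ∧ v = x :: t) ∨ GoodB u v

theorem GStep.perm {u v : List α} (h : GStep u v) : u ~ v := by
  rcases h with ⟨x, t, rfl, rfl⟩ | h
  · exact perm_append_comm
  · exact h.perm.symm

theorem reach_rot (x y : List α) : Relation.ReflTransGen GStep (x ++ y) (y ++ x) := by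
  induction y using List.reverseRecOn generalizing x with
  | nil => simpa using Relation.ReflTransGen.refl
  | append_singleton y c ih =>
    refine Relation.ReflTransGen.head (b := c :: x ++ y) (Or.inl ⟨c, x ++ y, by simp, by simp⟩) ?_
    simpa using ih (c :: x)

theorem reach_lift_B {w u : List α} {m : α} (h : GoodB w u) (hm : ∀ a ∈ w, a < m) :
    Relation.ReflTransGen GStep (m :: w) (m :: u) :=
  Relation.ReflTransGen.head (Or.inr (h.consMax hm)) (reach_rot u [m])

/-- Going backwards along a bijective step. -/
theorem reach_lift_B_inv {u : List α} {m : α} (hu : u.Nodup) (hm : ∀ a ∈ u, a < m) :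
    ∃ w, GoodB w u ∧ u.head? = w.getLast? ∧ Relation.ReflTransGen GStep (m :: u) (m :: w) := by
  let S := {l : List α // l ~ u}
  have hfin : Finite S := by
    have : {l : List α | l ~ u}.Finite := by
      refine (u.permutations.toFinset.finite_toSet).subset ?_
      intro l hl
      simpa using hl
    exact this.to_subtype
  have hex : ∀ l : S, ∃ w, GoodB w l.1 ∧ l.1.head? = w.getLast? := fun l =>
    GoodB.surj _ l.1 rfl (l.2.nodup_iff.2 hu)
  choose g hg1 hg2 using hex
  let G : S → S := fun l => ⟨g l, (hg1 l).perm.symm.trans l.2⟩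
  have hG : Function.Injective G := by
    intro a b hab
    have : g a = g b := congrArg Subtype.val hab
    have h1 := hg1 a
    rw [this] at h1
    exact Subtype.ext (h1.det (hg1 b))
  have back : ∀ l : S, Relation.ReflTransGen GStep (m :: (G l).1) (m :: l.1) := fun l =>
    reach_lift_B (hg1 l) fun a ha => hm a ((G l).2.subset ha)
  have backk : ∀ (k : ℕ) (l : S), Relation.ReflTransGen GStep (m :: (G^[k] l).1) (m :: l.1) := by
    intro k
    induction k with
    | zero => intro l; exact Relation.ReflTransGen.refl
    | succ k ih => intro l; exact (ih (G l)).trans (back l)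
  let l : S := ⟨u, Perm.refl _⟩
  obtain ⟨k, hk, hper⟩ := Function.mem_periodicPts.1 (hG.mem_periodicPts l)
  refine ⟨g l, hg1 l, hg2 l, ?_⟩
  obtain ⟨k, rfl⟩ : ∃ j, k = j + 1 := ⟨k - 1, by omega⟩
  have h1 := backk k (G l)
  rw [← Function.iterate_succ_apply, hper] at h1
  exact h1

theorem reach_lift_rot1 {v : List α} {x m : α} (hu : (x :: v).Nodup) (hm : ∀ a ∈ x :: v, a < m) :
    Relation.ReflTransGen GStep (m :: x :: v) (m :: (v ++ [x])) := by
  obtain ⟨w, h1, h2, h3⟩ := reach_lift_B_inv hu hm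
  refine h3.trans ?_
  refine (reach_rot [m] w).trans ?_
  have hw : w.Nodup := h1.perm.nodup_iff.1 hu
  rcases eq_nil_or_concat' w with rfl | ⟨t, c, rfl⟩
  · simp at h2
  simp at h2
  subst h2
  have hxt : x ∉ t := fun h => (nodup_append.1 hw).2.2 x h x (by simp) rfl
  have h4 := h1.insMax (b := x) hw (by simp) (fun a ha => hm a (h1.perm.symm.subset ha))
  have e1 : insAfter x m (t ++ [x]) = (t ++ [x]) ++ [m] := by
    rw [insAfter_append, insAfter_of_not_mem hxt]
    simp [insAfter]
  have e2 : (x :: v).map (fun y => if y = x then m else y) ++ [x] = m :: (v ++ [x]) := by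
    have : v.map (fun y => if y = x then m else y) = v := by
      conv_rhs => rw [← map_id v]
      refine map_congr_left fun y hy => ?_
      have : y ≠ x := by rintro rfl; exact (nodup_cons.1 hu).1 hy
      simp [this]
    simp [this]
  rw [e1, e2] at h4
  exact Relation.ReflTransGen.single (Or.inr h4)

theorem reach_lift_rot {m : α} (a b : List α) (hu : (a ++ b).Nodup) (hm : ∀ z ∈ a ++ b, z < m) :
    Relation.ReflTransGen GStep (m :: (a ++ b)) (m :: (b ++ a)) := by
  induction a generalizing b with
  | nil => simpa using Relation.ReflTransGen.refl
  | cons x a ih =>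
    refine (reach_lift_rot1 (v := a ++ b) (x := x) hu hm).trans ?_
    have hp : x :: a ++ b ~ a ++ (b ++ [x]) := by
      simpa using (perm_append_comm : [x] ++ (a ++ b) ~ (a ++ b) ++ [x])
    have := ih (b ++ [x]) (hp.nodup_iff.1 hu) (fun z hz => hm z (hp.symm.subset hz))
    simpa using this

theorem reach_lift {w v : List α} {m : α} (h : Relation.ReflTransGen GStep w v) (hw : w.Nodup)
    (hm : ∀ a ∈ w, a < m) : Relation.ReflTransGen GStep (m :: w) (m :: v) ∧ w ~ v := by
  induction h with
  | refl => exact ⟨Relation.ReflTransGen.refl, Perm.refl _⟩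
  | tail h1 h2 ih =>
    obtain ⟨i1, i2⟩ := ih
    refine ⟨i1.trans ?_, i2.trans h2.perm⟩
    have hn := i2.nodup_iff.1 hw
    have hm' := fun a ha => hm a (i2.symm.subset ha)
    rcases h2 with ⟨x, t, rfl, rfl⟩ | h2
    · exact reach_lift_rot t [x] hn hm'
    · exact reach_lift_B h2 hm'

theorem reach_all (n : ℕ) : ∀ x y : List α, x.length = n → x.Nodup → x ~ y →
    Relation.ReflTransGen GStep x y := by
  induction n with
  | zero =>
    intro x y hx _ h
    obtain rfl := length_eq_zero_iff.1 hx
    obtain rfl := h.symm.eq_nil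
    exact Relation.ReflTransGen.refl
  | succ n ih =>
    intro x y hx hn h
    have hne : x ≠ [] := by rintro rfl; simp at hx
    obtain ⟨m, hm, hmax⟩ := exists_max_mem x hne
    obtain ⟨a, b, rfl⟩ := append_of_mem hm
    obtain ⟨c, d, rfl⟩ := append_of_mem (h.subset hm)
    have p1 : a ++ m :: b ~ m :: (b ++ a) := perm_append_comm
    have p2 : c ++ m :: d ~ m :: (d ++ c) := perm_append_comm
    have hn1 := nodup_cons.1 (p1.nodup_iff.1 hn)
    have p3 : b ++ a ~ d ++ c := (perm_cons m).1 (p1.symm.trans (h.trans p2))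
    have hl : (b ++ a).length = n := by
      have := p1.length_eq; simp only [length_cons] at this; omega
    have key := ih _ _ hl hn1.2 p3
    have lift := (reach_lift (m := m) key hn1.2 (fun z hz =>
      lt_of_le_of_ne (hmax z (p1.symm.subset (mem_cons_of_mem _ hz)))
        (by rintro rfl; exact hn1.1 hz))).1
    refine (reach_rot a (m :: b)).trans (Relation.ReflTransGen.trans ?_ (reach_rot (m :: d) c))
    simpa using lift

theorem cons_lt_cons_of_lt {h k : α} (s t : List α) (hk : h < k) : (h :: s) < (k :: t) :=
  List.cons_lt_cons_iff.2 (Or.inl hk)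

theorem isLyndon_of_lt (h : α) (t : List α) (ht : ∀ y ∈ t, h < y) : IsLyndon (h :: t) := by
  refine ⟨by simp, fun i hi hi' => ?_⟩
  rw [drop_eq_getElem_cons hi']
  refine cons_lt_cons_of_lt _ _ (ht _ ?_)
  obtain ⟨j, rfl⟩ : ∃ j, i = j + 1 := ⟨i - 1, by omega⟩
  simp

theorem rotations_map (d h : α) (t : List α) :
    (rotations (h :: t)).map (fun l => (l.headD d, l.getLastD d)) =
      (h, t.getLastD h) :: zip t (h :: t) := by
  unfold rotations
  rw [length_cons, range_succ_eq_map, map_map, map_cons]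
  congr 1
  · simp [getLast?_cons]
  · refine List.ext_getElem (by simp) ?_
    intro i h1 h2
    have hi : i < t.length := by simpa using h1
    have e : take (i + 1) (h :: t) = take i (h :: t) ++ [(h :: t)[i]'(by simp; omega)] := by
      rw [take_append_getElem]
    simp only [map_map, getElem_map, getElem_range, Function.comp, getElem_zip, Nat.succ_eq_add_one]
    rw [e, drop_succ_cons, drop_eq_getElem_cons hi, ← append_assoc]
    simp only [cons_append, headD_cons]
    rw [← cons_append, getLastD_concat]

theorem headD_rotations_ne {w l : List α} (h : l ∈ rotations w) : l ≠ [] := by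
  unfold rotations at h
  obtain ⟨i, hi, rfl⟩ := mem_map.1 h
  have := mem_range.1 hi
  intro h
  have := congrArg length h
  simp at this
  omega

theorem GoodB.step {w u : List α} (hw : w.Nodup) (h : GoodB w u) : BBWTRotStep w u := by
  obtain ⟨fs, P, h1, rfl, h3, h4, rfl⟩ := h
  right
  refine ⟨fs.map (fun p => p.1 :: p.2), ⟨?_, ?_, ?_⟩, ?_⟩
  · simp [fword, flatMap_def]
  · intro f hf
    obtain ⟨p, hp, rfl⟩ := mem_map.1 hf
    exact isLyndon_of_lt _ _ (h1.1 p hp)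
  · refine Pairwise.isChain (pairwise_map.2 (h1.2.imp fun h => ?_))
    exact (cons_lt_cons_of_lt _ _ h).le
  · cases hfs : fs with
    | nil =>
      subst hfs
      have : P = [] := by simpa [fpairs] using h3
      simp [this, BBWTof]
    | cons q fs' =>
      rw [← hfs]
      let d := q.1
      let F : List α → α × α := fun l => (l.headD d, l.getLastD d)
      let r : α × α → α × α → Prop := fun a b => a.1 ≤ b.1
      let L := (fs.map (fun p => p.1 :: p.2)).flatMap rotations
      have hLne : ∀ l ∈ L, l ≠ [] := by
        intro l hl
        obtain ⟨_, _, hl⟩ := mem_flatMap.1 hl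
        exact headD_rotations_ne hl
      have hLP : L.map F ~ fpairs fs := by
        clear h1 h3 h4 hfs hw hLne
        simp only [L]
        induction fs with
        | nil => simp [fpairs]
        | cons p fs ih =>
          simp only [map_cons, flatMap_cons, map_append, fpairs] at ih ⊢
          refine Perm.append ?_ ih
          simp only [F]
          rw [rotations_map]
          exact (cycPairs_perm _ _ _).symm
      have hnd : (L.map (fun l => (F l).1)).Nodup := by
        have : L.map (fun l => (F l).1) = (L.map F).map Prod.fst := by simp
        rw [this]
        exact ((hLP.map Prod.fst).trans (fpairs_fst fs)).nodup_iff.2 hw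
      have hrel : ∀ a ∈ L, ∀ b ∈ L, omegaLE a b ↔ r (F a) (F b) := by
        intro a ha b hb
        by_cases hab : (F a).1 = (F b).1
        · have := inj_on_of_nodup_map hnd ha hb hab
          subst this
          simp [omegaLE, r]
        · cases a with
          | nil => exact absurd rfl (hLne _ ha)
          | cons a s =>
            cases b with
            | nil => exact absurd rfl (hLne _ hb)
            | cons b t =>
              simp only [F, headD_cons] at hab
              simp only [omegaLE, r, F, headD_cons, cons_append]
              rcases lt_or_gt_of_ne hab with h | h
              · exact iff_of_true (cons_lt_cons_of_lt _ _ h).le h.le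
              · exact iff_of_false (cons_lt_cons_of_lt _ _ h).not_ge h.not_ge
      have hsort := map_insertionSort omegaLE r F L hrel
      haveI : Std.Total r := ⟨fun a b => le_total _ _⟩
      haveI : IsTrans (α × α) r := ⟨fun a b c h h' => le_trans h h'⟩
      have hP : P = (L.map F).insertionSort r :=
        sorted_pairs_unique (h3.trans (hLP.symm.trans (perm_insertionSort _ _).symm)) h4
          (pairwise_insertionSort r _)
      rw [hP, ← hsort, map_map]
      unfold BBWTof
      change _ = flatMap _ (insertionSort omegaLE L)
      have hS : ∀ l ∈ insertionSort omegaLE L, l ≠ [] := fun l hl =>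
        hLne l ((mem_insertionSort _).1 hl)
      generalize insertionSort omegaLE L = S at hS
      induction S with
      | nil => rfl
      | cons l S ih =>
        rw [map_cons, flatMap_cons, ih (fun l hl => hS l (mem_cons_of_mem _ hl))]
        have hl := hS l (by simp)
        rcases eq_nil_or_concat' l with rfl | ⟨l, c, rfl⟩
        · exact absurd rfl hl
        · simp [F]

/-- If `x` and `y` are strings of the same length in which all symbols are
pairwise distinct and which have the same Parikh vector (i.e. they are
permutations of the same set of symbols), then `x` can be transformed into `y`
by a finite composition of `rot` and `BBWT` operations. -/
theorem reachable_of_perm_distinct (x y : List α) (hx : x.Nodup) (h : x.Perm y) :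
    Relation.ReflTransGen BBWTRotStep x y := by

  have key := reach_all _ x y rfl hx h
  suffices H : Relation.ReflTransGen BBWTRotStep x y ∧ x ~ y from H.1
  clear h
  induction key with
  | refl => exact ⟨Relation.ReflTransGen.refl, Perm.refl _⟩
  | tail h1 h2 ih =>
    refine ⟨ih.1.tail ?_, ih.2.trans h2.perm⟩
    have hn := ih.2.nodup_iff.1 hx
    rcases h2 with ⟨c, t, rfl, rfl⟩ | h2
    · left
      simp [rotR]
    · exact h2.step hn
end

section
/- For every nonempty string w, ℓ(w) ≤ r_B(w), where ℓ(w) is the number of distinct Lyndon factors in the Lyndon factorization of w and r_B(w) is the number of maximal character runs in BBWT(w). -/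
open List

variable {α : Type*} [LinearOrder α]

section Streams

set_option linter.unusedSectionVars false

variable [Inhabited α]

/-- Prepend a finite word to a stream. -/
def sapp (x : List α) (S : Lex (ℕ → α)) : Lex (ℕ → α) :=
  toLex fun n => if n < x.length then x.getD n default else ofLex S (n - x.length)

/-- The infinite periodic word of `x`. -/
def sKey (x : List α) : Lex (ℕ → α) := toLex fun n => x.getD (n % x.length) default

theorem slt_iff (S T : Lex (ℕ → α)) :
    S < T ↔ ∃ k, (∀ j < k, ofLex S j = ofLex T j) ∧ ofLex S k < ofLex T k := Iff.rfl

theorem sext {S T : Lex (ℕ → α)} (h : ∀ n, ofLex S n = ofLex T n) : S = T := by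
  apply ofLex.injective; funext n; exact h n

theorem sapp_nil (S : Lex (ℕ → α)) : sapp [] S = S := by
  apply sext; intro n; simp [sapp]

theorem sapp_cons_zero (a : α) (x : List α) (S : Lex (ℕ → α)) :
    ofLex (sapp (a :: x) S) 0 = a := by simp [sapp]

theorem sapp_cons_succ (a : α) (x : List α) (S : Lex (ℕ → α)) (n : ℕ) :
    ofLex (sapp (a :: x) S) (n + 1) = ofLex (sapp x S) n := by simp [sapp]

theorem sapp_append (x y : List α) (S : Lex (ℕ → α)) :
    sapp (x ++ y) S = sapp x (sapp y S) := by
  induction x with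
  | nil => simp [sapp_nil]
  | cons a x ih =>
    apply sext; intro n
    cases n with
    | zero => rw [List.cons_append, sapp_cons_zero, sapp_cons_zero]
    | succ n => simp only [List.cons_append, sapp_cons_succ, ih]

theorem sapp_cons_lt (a b : α) (x y : List α) (S T : Lex (ℕ → α)) :
    sapp (a :: x) S < sapp (b :: y) T ↔ a < b ∨ (a = b ∧ sapp x S < sapp y T) := by
  constructor
  · rintro ⟨k, h1, h2⟩
    cases k with
    | zero => left; exact h2
    | succ k =>
      right
      refine ⟨h1 0 (Nat.succ_pos _), k, fun j hj => ?_, ?_⟩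
      · have := h1 (j + 1) (by omega)
        exact (sapp_cons_succ a x S j).symm.trans (this.trans (sapp_cons_succ b y T j))
      · change ofLex (sapp (a :: x) S) (k + 1) < ofLex (sapp (b :: y) T) (k + 1) at h2
        rwa [sapp_cons_succ, sapp_cons_succ] at h2
  · rintro (h | ⟨rfl, k, h1, h2⟩)
    · exact ⟨0, fun j hj => absurd hj (by simp), h⟩
    · refine (slt_iff _ _).2 ⟨k + 1, fun j hj => ?_, ?_⟩
      · cases j with
        | zero => rfl
        | succ j => rw [sapp_cons_succ, sapp_cons_succ]; exact h1 j (by omega)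
      · rw [sapp_cons_succ, sapp_cons_succ]; exact h2

theorem sapp_lt (x : List α) (S T : Lex (ℕ → α)) : sapp x S < sapp x T ↔ S < T := by
  induction x with
  | nil => simp [sapp_nil]
  | cons a x ih => simp [sapp_cons_lt, ih]

theorem sapp_lt_of_lt {x y : List α} (h : x < y) (hl : y.length ≤ x.length)
    (S T : Lex (ℕ → α)) : sapp x S < sapp y T := by
  induction x generalizing y with
  | nil => cases y with
    | nil => exact absurd h (lt_irrefl _)
    | cons b y => simp at hl
  | cons a x ih =>
    cases y with
    | nil => exact absurd h (by simp)
    | cons b y =>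
      rw [sapp_cons_lt]
      rcases List.cons_lt_cons_iff.1 h with h | ⟨h, h'⟩
      · exact Or.inl h
      · exact Or.inr ⟨h, ih h' (by simpa using hl)⟩

theorem sKey_eq (x : List α) : sKey x = sapp x (sKey x) := by
  apply sext; intro n
  simp only [sapp, sKey, ofLex_toLex]
  split_ifs with h
  · rw [Nat.mod_eq_of_lt h]
  · rw [Nat.mod_eq_sub_mod (not_lt.1 h)]

theorem sapp_agree {x : List α} (hx : x ≠ []) {S T : Lex (ℕ → α)} {k : ℕ}
    (h : ∀ j < k, ofLex S j = ofLex T j) : ∀ j ≤ k, ofLex (sapp x S) j = ofLex (sapp x T) j := by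
  intro j hj
  have := List.length_pos_iff.2 hx
  simp only [sapp, ofLex_toLex]
  split_ifs with h1
  · rfl
  · exact h _ (by omega)

theorem lt_sapp_of_lt_sKey {x : List α} (hx : x ≠ []) {Z : Lex (ℕ → α)} (h : Z < sKey x) :
    Z < sapp x Z := by
  obtain ⟨k, h1, h2⟩ := (slt_iff _ _).1 h
  have h3 := sapp_agree hx h1
  rw [← sKey_eq] at h3
  exact (slt_iff _ _).2 ⟨k, fun j hj => (h1 j hj).trans (h3 j hj.le).symm, (h3 k le_rfl).symm ▸ h2⟩

theorem sapp_lt_of_sKey_lt {x : List α} (hx : x ≠ []) {Z : Lex (ℕ → α)} (h : sKey x < Z) :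
    sapp x Z < Z := by
  obtain ⟨k, h1, h2⟩ := (slt_iff _ _).1 h
  have h3 := sapp_agree hx h1
  rw [← sKey_eq] at h3
  exact (slt_iff _ _).2 ⟨k, fun j hj => (h3 j hj.le).symm.trans (h1 j hj), (h3 k le_rfl) ▸ h2⟩

theorem eq_sKey_of_sapp_eq {x : List α} (hx : x ≠ []) {Z : Lex (ℕ → α)} (h : sapp x Z = Z) :
    Z = sKey x := by
  rcases lt_trichotomy Z (sKey x) with h1 | h1 | h1
  · have := lt_sapp_of_lt_sKey hx h1; rw [h] at this; exact absurd this (lt_irrefl _)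
  · exact h1
  · have := sapp_lt_of_sKey_lt hx h1; rw [h] at this; exact absurd this (lt_irrefl _)

theorem sKey_lt_of_sapp_lt {x : List α} (hx : x ≠ []) {Z : Lex (ℕ → α)} (h : sapp x Z < Z) :
    sKey x < Z := by
  rcases lt_trichotomy Z (sKey x) with h1 | h1 | h1
  · exact absurd h (lt_sapp_of_lt_sKey hx h1).not_gt
  · rw [h1, ← sKey_eq] at h; exact absurd h (lt_irrefl _)
  · exact h1

theorem lt_sKey_of_lt_sapp {x : List α} (hx : x ≠ []) {Z : Lex (ℕ → α)} (h : Z < sapp x Z) :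
    Z < sKey x := by
  rcases lt_trichotomy Z (sKey x) with h1 | h1 | h1
  · exact h1
  · rw [h1, ← sKey_eq] at h; exact absurd h (lt_irrefl _)
  · exact absurd h (sapp_lt_of_sKey_lt hx h1).not_gt

theorem sKey_lt_of_lt {x y : List α} (hx : x ≠ []) (hy : y ≠ []) (h : x ++ y < y ++ x) :
    sKey x < sKey y := by
  have h1 := sapp_lt_of_lt h (by simp [add_comm]) (sKey x) (sKey x)
  rw [sapp_append, sapp_append, ← sKey_eq] at h1
  exact lt_sKey_of_lt_sapp hy (sKey_lt_of_sapp_lt hx h1)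

theorem sKey_eq_of_eq {x y : List α} (hx : x ≠ []) (hy : y ≠ []) (h : x ++ y = y ++ x) :
    sKey x = sKey y := by
  have h1 : sapp (x ++ y) (sKey x) = sapp (y ++ x) (sKey x) := by rw [h]
  rw [sapp_append, sapp_append, ← sKey_eq] at h1
  exact eq_sKey_of_sapp_eq hy (eq_sKey_of_sapp_eq hx h1)

theorem omegaLE_iff {x y : List α} (hx : x ≠ []) (hy : y ≠ []) :
    omegaLE x y ↔ sKey x ≤ sKey y := by
  unfold omegaLE
  rcases lt_trichotomy (x ++ y) (y ++ x) with h | h | h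
  · exact ⟨fun _ => (sKey_lt_of_lt hx hy h).le, fun _ => h.le⟩
  · exact ⟨fun _ => (sKey_eq_of_eq hx hy h).le, fun _ => h.le⟩
  · exact ⟨fun h' => absurd h h'.not_gt, fun h' => absurd (sKey_lt_of_lt hy hx h) h'.not_gt⟩

theorem append_comm_of_sKey_eq {x y : List α} (hx : x ≠ []) (hy : y ≠ []) (h : sKey x = sKey y) :
    x ++ y = y ++ x :=
  le_antisymm ((omegaLE_iff hx hy).2 h.le) ((omegaLE_iff hy hx).2 h.ge)

/-- Last character. -/
def lastC (x : List α) : α := x.getLast?.getD default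

theorem lastC_eq_of_sKey_eq {x y : List α} (hx : x ≠ []) (hy : y ≠ []) (h : sKey x = sKey y) :
    lastC x = lastC y := by
  have h1 := congrArg List.getLast? (append_comm_of_sKey_eq hx hy h)
  rw [List.getLast?_append_of_ne_nil _ hy, List.getLast?_append_of_ne_nil _ hx] at h1
  simp [lastC, h1]

theorem sKey_rot (u v : List α) : sKey (u ++ v) = sapp u (sKey (v ++ u)) := by
  by_cases h : u ++ v = []
  · obtain ⟨rfl, rfl⟩ := List.append_eq_nil_iff.1 h
    simp [sapp_nil]
  · refine (eq_sKey_of_sapp_eq h ?_).symm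
    rw [← sapp_append, List.append_assoc, sapp_append u (v ++ u), ← sKey_eq]

theorem sKey_rotR {x : List α} (hx : x ≠ []) : sKey (rotR x) = sapp [lastC x] (sKey x) := by
  obtain ⟨l, a, rfl⟩ : ∃ l a, x = l ++ [a] := ⟨_, _, (List.dropLast_append_getLast hx).symm⟩
  have : rotR (l ++ [a]) = [a] ++ l := by simp [rotR]
  rw [this, sKey_rot]; simp [lastC]

theorem rotR_eq_rotate (x : List α) : rotR x = x.rotate (x.length - 1) := by
  rw [List.rotate_eq_drop_append_take (by omega)]; rfl

theorem rotR_iterate (x : List α) (k : ℕ) : rotR^[k] x = x.rotate (k * (x.length - 1)) := by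
  induction k with
  | zero => simp
  | succ k ih =>
    rw [Function.iterate_succ_apply', ih, rotR_eq_rotate, List.rotate_rotate, List.length_rotate]
    congr 1; ring

theorem rotR_iterate_mul (x : List α) (k : ℕ) : rotR^[x.length * k] x = x := by
  rw [rotR_iterate, mul_assoc, List.rotate_length_mul]

theorem mem_rotations {x f : List α} : x ∈ rotations f ↔ f ≠ [] ∧ ∃ n, x = f.rotate n := by
  unfold rotations
  simp only [List.mem_map, List.mem_range]
  constructor
  · rintro ⟨i, hi, rfl⟩
    refine ⟨List.length_pos_iff.1 (by omega), i, ?_⟩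
    rw [List.rotate_eq_drop_append_take hi.le]
  · rintro ⟨h, n, rfl⟩
    have := List.length_pos_iff.2 h
    refine ⟨n % f.length, Nat.mod_lt _ this, ?_⟩
    rw [← List.rotate_eq_drop_append_take (Nat.mod_lt _ this).le, List.rotate_mod]

theorem rotate_mem_rotations {x f : List α} (h : x ∈ rotations f) (m : ℕ) :
    x.rotate m ∈ rotations f := by
  obtain ⟨hf0, n, rfl⟩ := mem_rotations.1 h
  exact mem_rotations.2 ⟨hf0, n + m, List.rotate_rotate _ _ _⟩

theorem rotations_ne_nil {x f : List α} (h : x ∈ rotations f) : x ≠ [] := by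
  obtain ⟨hf0, n, rfl⟩ := mem_rotations.1 h
  simpa using hf0

/-- Every factor has a rotation at which a run ends. -/
theorem exists_run_end (fs : List (List α)) (f : List α) (hf : f ∈ fs) (hne : f ≠ []) :
    ∃ x ∈ rotations f, ∀ y ∈ fs.flatMap rotations, sKey x < sKey y →
      (∀ z ∈ fs.flatMap rotations, ¬ (sKey x < sKey z ∧ sKey z < sKey y)) → lastC y ≠ lastC x := by
  by_contra! hcon
  set L := fs.flatMap rotations with hL
  have hLne : ∀ z ∈ L, z ≠ [] := by
    intro z hz
    obtain ⟨g, _, hz⟩ := List.mem_flatMap.1 hz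
    exact rotations_ne_nil hz
  have hLrot : ∀ z ∈ L, ∀ m, z.rotate m ∈ L := by
    intro z hz m
    obtain ⟨g, hg, hz⟩ := List.mem_flatMap.1 hz
    exact List.mem_flatMap.2 ⟨g, hg, rotate_mem_rotations hz m⟩
  have hfL : ∀ x ∈ rotations f, x ∈ L := fun x hx => List.mem_flatMap.2 ⟨f, hf, hx⟩
  let P : List α → List α → Prop := fun x y => x ∈ rotations f ∧ y ∈ L ∧ sKey x < sKey y ∧
    (∀ z ∈ L, ¬ (sKey x < sKey z ∧ sKey z < sKey y)) ∧ lastC y = lastC x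
  have step : ∀ x y, P x y → P (rotR x) (rotR y) := by
    rintro x y ⟨hx, hy, hlt, hadj, hc⟩
    have hxn := rotations_ne_nil hx
    have hyn := hLne y hy
    have hx' : rotR x ∈ rotations f := by rw [rotR_eq_rotate]; exact rotate_mem_rotations hx _
    have hy' : rotR y ∈ L := by rw [rotR_eq_rotate]; exact hLrot y hy _
    have hlt' : sKey (rotR x) < sKey (rotR y) := by
      rw [sKey_rotR hxn, sKey_rotR hyn, hc, sapp_lt]; exact hlt
    have hadj' : ∀ z ∈ L, ¬ (sKey (rotR x) < sKey z ∧ sKey z < sKey (rotR y)) := by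
      rintro z hz ⟨h1, h2⟩
      have hzn := hLne z hz
      obtain ⟨a, l, rfl⟩ := List.exists_cons_of_ne_nil hzn
      have hk : sKey (a :: l) = sapp [a] (sKey (l ++ [a])) := sKey_rot [a] l
      have hm : l ++ [a] ∈ L := by simpa using hLrot _ hz 1
      rw [sKey_rotR hxn, hk, sapp_cons_lt, sapp_nil, sapp_nil] at h1
      rw [sKey_rotR hyn, hk, sapp_cons_lt, sapp_nil, sapp_nil, hc] at h2
      rcases h1 with h1 | ⟨e1, h1⟩
      · rcases h2 with h2 | ⟨e2, h2⟩
        · exact absurd h1 h2.not_gt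
        · exact absurd h1 e2.not_gt
      · rcases h2 with h2 | ⟨e2, h2⟩
        · exact absurd h2 e1.not_gt
        · exact hadj _ hm ⟨h1, h2⟩
    refine ⟨hx', hy', hlt', hadj', ?_⟩
    obtain ⟨y', hy'L, hl, ha, hc'⟩ := hcon _ hx'
    rw [← hc']
    apply lastC_eq_of_sKey_eq (hLne _ hy') (hLne _ hy'L)
    apply le_antisymm
    · by_contra! hh
      exact hadj' y' hy'L ⟨hl, hh⟩
    · by_contra! hh
      exact ha (rotR y) hy' hlt' hh
  have hff : f ∈ rotations f := mem_rotations.2 ⟨hne, 0, by simp⟩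
  obtain ⟨y, hP⟩ : ∃ y, P f y := by
    obtain ⟨y, h1, h2, h3, h4⟩ := hcon f hff
    exact ⟨y, hff, h1, h2, fun z hz h => h3 z hz h.1 h.2, h4⟩
  have hiter : ∀ k, P (rotR^[k] f) (rotR^[k] y) ∧
      ∀ j < k, ofLex (sKey (rotR^[k] f)) j = ofLex (sKey (rotR^[k] y)) j := by
    intro k
    induction k with
    | zero => exact ⟨hP, fun j hj => absurd hj (by simp)⟩
    | succ k ih =>
      obtain ⟨ih1, ih2⟩ := ih
      simp only [Function.iterate_succ_apply']
      refine ⟨step _ _ ih1, fun j hj => ?_⟩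
      rw [sKey_rotR (rotations_ne_nil ih1.1), sKey_rotR (hLne _ ih1.2.1), ih1.2.2.2.2]
      exact sapp_agree (by simp) ih2 j (by omega)
  have heq : sKey f = sKey y := by
    apply sext; intro n
    have h1 := (hiter (f.length * (y.length * (n + 1)))).2 n (by
      have := List.length_pos_iff.2 hne
      have := List.length_pos_iff.2 (hLne y hP.2.1)
      nlinarith [Nat.mul_pos ‹0 < f.length› this])
    have e1 := rotR_iterate_mul f (y.length * (n + 1))
    have e2 := rotR_iterate_mul y (f.length * (n + 1))
    rw [Nat.mul_left_comm] at e2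
    rwa [e1, e2] at h1
  exact absurd hP.2.2.1 (by rw [heq]; exact lt_irrefl _)

theorem sKey_rotate (f : List α) (n : ℕ) (k : ℕ) :
    ofLex (sKey (f.rotate n)) k = ofLex (sKey f) (k + n) := by
  rcases eq_or_ne f [] with rfl | hf
  · simp [sKey]
  · have := List.length_pos_iff.2 hf
    simp only [sKey, ofLex_toLex, List.length_rotate, List.getD_eq_getElem?_getD]
    rw [List.getElem?_rotate (Nat.mod_lt _ this), Nat.mod_add_mod]

theorem sKey_rotate_congr {f g : List α} (h : sKey f = sKey g) (n : ℕ) :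
    sKey (f.rotate n) = sKey (g.rotate n) := by
  apply sext; intro k
  rw [sKey_rotate, sKey_rotate, h]

theorem lyndon_min {f : List α} (hf : IsLyndon f) (n : ℕ) : sKey f ≤ sKey (f.rotate n) := by
  have hpos := List.length_pos_iff.2 hf.1
  have hm := Nat.mod_lt n hpos
  rw [← List.rotate_mod]
  generalize n % f.length = m at hm
  rcases Nat.eq_zero_or_pos m with rfl | h0
  · simp
  · rw [List.rotate_eq_drop_append_take hm.le, sKey_rot, List.take_append_drop]
    conv_lhs => rw [sKey_eq]
    exact (sapp_lt_of_lt (hf.2 m h0 hm) (by simp) _ _).le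

theorem lyndon_key_le {f g : List α} (hg : IsLyndon g) {x y : List α}
    (hx : x ∈ rotations f) (hy : y ∈ rotations g) (h : sKey x = sKey y) : sKey g ≤ sKey f := by
  obtain ⟨hf0, i, rfl⟩ := mem_rotations.1 hx
  obtain ⟨hg0, j, rfl⟩ := mem_rotations.1 hy
  have hpos := List.length_pos_iff.2 hf0
  have h1 := sKey_rotate_congr h ((f.length - 1) * i)
  have e : i + (f.length - 1) * i = f.length * i := by
    obtain ⟨m, hm⟩ := Nat.exists_eq_succ_of_ne_zero hpos.ne'
    rw [hm]; simp; ring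
  rw [List.rotate_rotate, List.rotate_rotate, e, List.rotate_length_mul] at h1
  rw [h1]
  exact lyndon_min hg _

theorem lyndon_comm {f g : List α} (hf : IsLyndon f) (hg : IsLyndon g)
    (hl : f.length ≤ g.length) (h : f ++ g = g ++ f) : f = g := by
  have hpos := List.length_pos_iff.2 hf.1
  have hp : f <+: g := List.prefix_of_prefix_length_le (l₃ := f ++ g) (List.prefix_append _ _)
    (h ▸ List.prefix_append _ _) hl
  have hsu : f <:+ g := List.suffix_of_suffix_length_le (l₃ := g ++ f) (List.suffix_append _ _)
    (h ▸ List.suffix_append _ _) hl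
  rcases hl.eq_or_lt with he | hlt
  · exact hp.eq_of_length he
  · exfalso
    obtain ⟨u, hu⟩ := hsu
    have hul : u.length + f.length = g.length := by rw [← hu]; simp
    have h1 := hg.2 u.length (by omega) (by omega)
    have h2 : g.drop u.length = f := by rw [← hu]; simp
    rw [h2] at h1
    obtain ⟨v, hv⟩ := hp
    have h3 : f ≤ g := by
      rw [← hv]
      clear * -
      apply not_lt.1
      induction f with
      | nil => exact List.not_lt_nil _
      | cons a f ih =>
        intro h
        rcases List.cons_lt_cons_iff.1 h with h | ⟨_, h⟩
        · exact lt_irrefl _ h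
        · exact ih h
    exact absurd h1 h3.not_gt

theorem lyndon_inj {f g : List α} (hf : IsLyndon f) (hg : IsLyndon g) {x y : List α}
    (hx : x ∈ rotations f) (hy : y ∈ rotations g) (h : sKey x = sKey y) : f = g := by
  have hk : sKey f = sKey g := le_antisymm (lyndon_key_le hf hy hx h.symm) (lyndon_key_le hg hx hy h)
  have hc := append_comm_of_sKey_eq hf.1 hg.1 hk
  rcases le_total f.length g.length with hl | hl
  · exact lyndon_comm hf hg hl hc
  · exact (lyndon_comm hg hf hl hc.symm).symm

end Streams

theorem runCount_cons_cons {γ : Type*} [LinearOrder γ] (a b : γ) (l : List γ) :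
    runCount (a :: b :: l) = (if a ≠ b then 1 else 0) + runCount (b :: l) := by
  unfold runCount
  rw [List.destutter_cons_cons]
  split_ifs with h
  · simp [add_comm, List.destutter_cons']
  · have : a = b := by simpa using h
    subst this
    simp [List.destutter_cons']

theorem runCount_lemma {β κ γ : Type*} [LinearOrder κ] [LinearOrder γ] (key : β → κ) (c : β → γ)
    (s : List β) (hs : s.Pairwise (fun a b => key a ≤ key b))
    (hc : ∀ a ∈ s, ∀ b ∈ s, key a = key b → c a = c b) (D : Finset κ)
    (hD : ∀ k ∈ D, ∃ a ∈ s, key a = k ∧ ∀ y ∈ s, k < key y →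
      (∀ z ∈ s, ¬ (k < key z ∧ key z < key y)) → c y ≠ c a) :
    D.card ≤ runCount (s.map c) := by
  induction s generalizing D with
  | nil =>
    have : D = ∅ := by
      apply Finset.eq_empty_of_forall_notMem
      intro k hk
      obtain ⟨a, ha, _⟩ := hD k hk
      simp at ha
    simp [this]
  | cons a t ih =>
    cases t with
    | nil =>
      have h1 : D ⊆ {key a} := by
        intro k hk
        obtain ⟨a', ha, hk, _⟩ := hD k hk
        simp at ha
        simp [← hk, ha]
      simpa [runCount] using Finset.card_le_card h1
    | cons b l =>
      have hs' := List.pairwise_cons.1 hs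
      have hs2 := List.pairwise_cons.1 hs'.2
      have hc' : ∀ x ∈ b :: l, ∀ y ∈ b :: l, key x = key y → c x = c y :=
        fun x hx y hy => hc x (List.mem_cons_of_mem _ hx) y (List.mem_cons_of_mem _ hy)
      have hab : key a ≤ key b := hs'.1 b (by simp)
      have hbmin : ∀ x ∈ b :: l, key b ≤ key x := by
        intro x hx
        rcases List.mem_cons.1 hx with rfl | hx
        · exact le_rfl
        · exact hs2.1 x hx
      have hred : ∀ k ∈ D, (k = key a → key a = key b) →
          ∃ a' ∈ b :: l, key a' = k ∧ ∀ y ∈ b :: l, k < key y →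
          (∀ z ∈ b :: l, ¬ (k < key z ∧ key z < key y)) → c y ≠ c a' := by
        intro k hk hka
        obtain ⟨a', ha', hk', h⟩ := hD k hk
        obtain ⟨a'', h1, h2, h3⟩ : ∃ a'' ∈ b :: l, key a'' = k ∧ c a'' = c a' := by
          rcases List.mem_cons.1 ha' with rfl | hm
          · exact ⟨b, by simp, (hka hk'.symm).symm.trans hk',
              hc b (by simp) a' (by simp) (hka hk'.symm).symm⟩
          · exact ⟨a', hm, hk', rfl⟩
        refine ⟨a'', h1, h2, fun y hy hlt hadj => ?_⟩
        rw [h3]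
        refine h y (List.mem_cons_of_mem _ hy) hlt fun z hz => ?_
        rcases List.mem_cons.1 hz with rfl | hz
        · rintro ⟨h4, _⟩
          exact absurd (h2 ▸ hs'.1 a'' h1) h4.not_ge
        · exact hadj z hz
      rw [List.map_cons, List.map_cons, runCount_cons_cons, ← List.map_cons]
      rcases hab.eq_or_lt with he | hlt
      · exact (ih hs'.2 hc' D fun k hk => hred k hk fun _ => he).trans (Nat.le_add_left _ _)
      · have h1 := ih hs'.2 hc' (D.erase (key a)) fun k hk =>
          hred k (Finset.mem_of_mem_erase hk) fun h => absurd h (Finset.ne_of_mem_erase hk)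
        by_cases hm : key a ∈ D
        · have hne : c a ≠ c b := by
            obtain ⟨a', ha', hk', h⟩ := hD _ hm
            have hca : c a' = c a := hc a' ha' a (by simp) hk'
            rw [← hca]
            refine (h b (by simp) hlt fun z hz => ?_).symm
            rintro ⟨h4, h5⟩
            rcases List.mem_cons.1 hz with rfl | hz
            · exact lt_irrefl _ h4
            · exact absurd h5 (hbmin z hz).not_gt
          rw [if_pos hne]
          have := Finset.card_erase_add_one hm
          omega
        · rw [Finset.erase_eq_of_notMem hm] at h1
          omega

/-- For every nonempty word `w` with Lyndon factorization `fs`, the number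
`ℓ(w)` of distinct Lyndon factors is at most the number `r_B(w)` of maximal
character runs in `BBWT(w)`. -/
theorem numLyndonFactors_le_bbwt_runs (w : List α) (hw : w ≠ [])
    (fs : List (List α)) (hfs : IsLyndonFactorization w fs) :
    fs.dedup.length ≤ runCount (BBWTof fs) := by
  classical
  obtain ⟨a0, -⟩ := List.exists_mem_of_ne_nil w hw
  have : Inhabited α := ⟨a0⟩
  obtain ⟨-, hL, -⟩ := hfs
  have hne : ∀ z ∈ fs.flatMap rotations, z ≠ [] := by
    intro z hz
    obtain ⟨g, _, hz⟩ := List.mem_flatMap.1 hz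
    exact rotations_ne_nil hz
  set s := List.insertionSort omegaLE (fs.flatMap rotations) with hs
  have hmem : ∀ z, z ∈ s ↔ z ∈ fs.flatMap rotations := fun z => List.mem_insertionSort _
  have hsorted : s.Pairwise (fun a b => sKey a ≤ sKey b) := by
    have h1 := List.map_insertionSort (r := omegaLE) (s := (· ≤ ·)) sKey (fs.flatMap rotations)
      (fun a ha b hb => omegaLE_iff (hne a ha) (hne b hb))
    have h2 := List.pairwise_insertionSort (· ≤ ·) ((fs.flatMap rotations).map sKey)
    rw [← h1, List.pairwise_map] at h2
    exact h2
  have hB : BBWTof fs = s.map lastC := by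
    have : ∀ t : List (List α), (∀ z ∈ t, z ≠ []) →
        (t.flatMap fun r => r.getLast?.toList) = t.map lastC := by
      intro t ht
      induction t with
      | nil => rfl
      | cons z t ih =>
        have hz := ht z (by simp)
        rw [List.flatMap_cons, ih fun z hz => ht z (by simp [hz]), List.map_cons]
        simp [lastC, List.getLast?_eq_getLast_of_ne_nil hz]
    exact this s fun z hz => hne z ((hmem z).1 hz)
  rw [hB]
  have hex : ∀ f : List α, ∃ x, f ∈ fs → x ∈ rotations f ∧ ∀ y ∈ fs.flatMap rotations,
      sKey x < sKey y →
      (∀ z ∈ fs.flatMap rotations, ¬ (sKey x < sKey z ∧ sKey z < sKey y)) →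
      lastC y ≠ lastC x := by
    intro f
    by_cases hf : f ∈ fs
    · obtain ⟨x, h1, h2⟩ := exists_run_end fs f hf (hL f hf).1
      exact ⟨x, fun _ => ⟨h1, h2⟩⟩
    · exact ⟨[], fun h => absurd h hf⟩
  choose X hX using hex
  have hcard : (fs.toFinset.image fun f => sKey (X f)).card = fs.dedup.length := by
    rw [Finset.card_image_of_injOn, List.card_toFinset]
    · intro f hf g hg h
      have hf' : f ∈ fs := by simpa using hf
      have hg' : g ∈ fs := by simpa using hg
      exact lyndon_inj (hL f hf') (hL g hg') (hX f hf').1 (hX g hg').1 h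
  rw [← hcard]
  apply runCount_lemma sKey lastC s hsorted
  · intro a ha b hb h
    exact lastC_eq_of_sKey_eq (hne a ((hmem a).1 ha)) (hne b ((hmem b).1 hb)) h
  · intro k hk
    obtain ⟨f, hf, rfl⟩ := Finset.mem_image.1 hk
    have hf' : f ∈ fs := by simpa using hf
    refine ⟨X f, (hmem _).2 (List.mem_flatMap.2 ⟨f, hf', (hX f hf').1⟩), rfl, ?_⟩
    simp only [hmem]
    exact (hX f hf').2
end
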